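/- arXiv:2008.12167 — 2 statements merged into one kernel-verified Lean document; each statement's English description precedes it below -/
import Mathlib

section
/- Given a degree sequence d = (d(1),…,d(n)) and a rooted tree t on vertex set [n], for integers b₁,b₂,a₁,a₂ let R_{b₁,b₂,a₁,a₂}(t,d) = #{u ∈ v(t)∖{r(t)} : d(u) = b₁, d(parent(u)) = b₂, c_t(u) = a₁, c_t(parent(u)) = a₂}. Then under the standing assumptions, for any integers 0 ≤ a₁ < b₁ and 0 ≤ a₂ < b₂, as n → ∞, R_{b₁,b₂,a₁,a₂}(T(d^n),d^n)/n converges in probability to a₂·p(b₂)·P(Bin(b₂−1,ρ)=a₂) · p(b₁)·P(Bin(b₁−1,ρ)=a₁). -/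
open Classical Filter

namespace TWG

/-- Half-edges for the degree sequence `d`: vertex `i` carries `d i` half-edges,
encoded as `⟨i, j⟩` for `j : Fin (d i)`; `⟨i, d i - 1⟩` is the root half-edge of `i`. -/
abbrev HE {n : ℕ} (d : Fin n → ℕ) := (i : Fin n) × Fin (d i)

def IsRootHE {n : ℕ} (d : Fin n → ℕ) (h : HE d) : Prop := (h.2 : ℕ) = d h.1 - 1

def IsNonRootHE {n : ℕ} (d : Fin n → ℕ) (h : HE d) : Prop := (h.2 : ℕ) < d h.1 - 1

/-- A candidate execution path: at each of the `n-1` steps, a pair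
(root half-edge `r_k`, non-root half-edge `s_k`) is chosen. -/
abbrev Path {n : ℕ} (d : Fin n → ℕ) := Fin (n - 1) → HE d × HE d

/-- Vertices `a` and `b` lie in the same tree of the forest present at the start of
step `k`, i.e. they are joined by the edges created at steps `j < k`. -/
def SameTree {n : ℕ} {d : Fin n → ℕ} (E : Path d) (k : Fin (n - 1)) (a b : Fin n) : Prop :=
  Relation.ReflTransGen
    (fun x y => ∃ j, j < k ∧
      (((E j).1.1 = x ∧ (E j).2.1 = y) ∨ ((E j).1.1 = y ∧ (E j).2.1 = x))) a b

/-- `E` is a valid execution path of Pitman's additive coalescent for `d`: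
at each step, `r_k` is an as-yet-unpaired root half-edge, `s_k` is an
as-yet-unpaired non-root half-edge, and they lie in different trees of the
current forest. -/
def IsExecPath {n : ℕ} (d : Fin n → ℕ) (E : Path d) : Prop :=
  ∀ k : Fin (n - 1),
    IsRootHE d (E k).1 ∧ IsNonRootHE d (E k).2 ∧
    (∀ j, j < k → (E j).1 ≠ (E k).1) ∧
    (∀ j, j < k → (E j).2 ≠ (E k).2) ∧
    ¬ SameTree E k (E k).1.1 (E k).2.1

/-- The number of children of vertex `i` in the tree `T(d)` built by `E`. -/
noncomputable def cc {n : ℕ} {d : Fin n → ℕ} (E : Path d) (i : Fin n) : ℕ :=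
  Nat.card {k : Fin (n - 1) // (E k).2.1 = i}

/-- `v` is a non-root vertex of the tree built by `E`. -/
def IsNonRootV {n : ℕ} {d : Fin n → ℕ} (E : Path d) (v : Fin n) : Prop :=
  ∃ k, (E k).1.1 = v

/-- The parent of `v` in the tree built by `E` (equal to `v` itself for the root). -/
noncomputable def parentOf {n : ℕ} {d : Fin n → ℕ} (E : Path d) (v : Fin n) : Fin n :=
  if h : ∃ k, (E k).1.1 = v then (E h.choose).2.1 else v

/-- The tree built by `E` is the rooted tree with root `root` and parent map `par`. -/
def TreeEq {n : ℕ} {d : Fin n → ℕ} (E : Path d) (root : Fin n) (par : Fin n → Fin n) : Prop :=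
  (∀ k, par (E k).1.1 = (E k).2.1) ∧ ∀ v, v ≠ root → ∃ k, (E k).1.1 = v

/-- `(root, par)` encodes a rooted tree on `Fin n`: the root is a fixed point of the
parent map and every vertex reaches the root by iterating the parent map. -/
def IsRootedTree {n : ℕ} (root : Fin n) (par : Fin n → Fin n) : Prop :=
  par root = root ∧ ∀ v, ∃ m, par^[m] v = root

/-- The number of children of `i` in the rooted tree `(root, par)`. -/
noncomputable def childCount {n : ℕ} (root : Fin n) (par : Fin n → Fin n) (i : Fin n) : ℕ :=
  Nat.card {v : Fin n // v ≠ root ∧ par v = i}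

/-- `h` is one of the half-edges paired during the execution path `E`. -/
def UsedIn {n : ℕ} {d : Fin n → ℕ} (E : Path d) (h : HE d) : Prop :=
  (∃ k, (E k).1 = h) ∨ (∃ k, (E k).2 = h)

/-- `M` pairs up, as a fixed-point-free involution, exactly the half-edges left
unpaired by `E` (its fixed points are exactly the half-edges used by `E`). -/
def IsCompletion {n : ℕ} {d : Fin n → ℕ} (E : Path d) (M : HE d → HE d) : Prop :=
  Function.Involutive M ∧ ∀ h, (M h = h ↔ UsedIn E h)

/-- The number of half-edges at `u`, unpaired by `E`, which `M` matches to a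
half-edge at `v`.  For `u ≠ v` this is the number of `M`-edges joining `u` and `v`;
for `u = v` it is twice the number of `M`-loops at `u`. -/
noncomputable def matchCount {n : ℕ} {d : Fin n → ℕ} (E : Path d) (M : HE d → HE d)
    (u v : Fin n) : ℕ :=
  Nat.card {h : HE d // ¬ UsedIn E h ∧ h.1 = u ∧ (M h).1 = v}

/-- `P(Bin(m, ρ) = a)`. -/
noncomputable def binomP (ρ : ℝ) (m a : ℕ) : ℝ :=
  (m.choose a : ℝ) * ρ ^ a * (1 - ρ) ^ (m - a)


/-- `μ₁(p) = ∑ k, k⋅p(k)`. -/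
noncomputable def mu1 (p : ℕ → ℝ) : ℝ := ∑' k : ℕ, (k : ℝ) * p k

/-- `ρ = 1/(μ₁(p) - 1)`. -/
noncomputable def rho (p : ℕ → ℝ) : ℝ := 1 / (mu1 p - 1)

/-- `R_{b₁,b₂,a₁,a₂}(T(d), d)`: the number of non-root vertices `u` of the tree built
by the execution path `E` with `d u = b₁`, `d (parent u) = b₂`, `c u = a₁` and
`c (parent u) = a₂`. -/
noncomputable def Rcount {n : ℕ} {d : Fin n → ℕ} (E : Path d)
    (b₁ b₂ a₁ a₂ : ℕ) : ℕ :=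
  Nat.card {u : Fin n // IsNonRootV E u ∧ d u = b₁ ∧ d (parentOf E u) = b₂ ∧
    cc E u = a₁ ∧ cc E (parentOf E u) = a₂}

section Forest

/-- Merging the tree rooted at `u` into the tree rooted at `z`. -/
noncomputable def mrg {n : ℕ} (ρ : Fin n → Fin n) (u z : Fin n) : Fin n → Fin n :=
  fun x => if ρ x = u then z else ρ x

/-- Order-free description of execution paths (at the level of vertices), relative
to a root map `ρ`. -/
def Acy {n k : ℕ} (ρ : Fin n → Fin n) (v r : Fin k → Fin n) : Prop :=
  Function.Injective r ∧ (∀ i, r i ∈ Set.range ρ) ∧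
    ∃ h : Fin n → ℕ, ∀ i, h (ρ (v i)) < h (r i)

lemma mrg_idem {n : ℕ} {ρ : Fin n → Fin n} (hρ : ∀ x, ρ (ρ x) = ρ x) {u y : Fin n}
    (hu : u ≠ ρ y) (x : Fin n) : mrg ρ u (ρ y) (mrg ρ u (ρ y) x) = mrg ρ u (ρ y) x := by
  unfold mrg
  by_cases h : ρ x = u
  · simp [h, hρ, hu.symm]
  · simp [h, hρ]

lemma mrg_range {n : ℕ} {ρ : Fin n → Fin n} {u y : Fin n}
    (hu : u ≠ ρ y) : Set.range (mrg ρ u (ρ y)) = Set.range ρ \ {u} := by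
  ext z
  simp only [Set.mem_range, Set.mem_sdiff, Set.mem_singleton_iff, mrg]
  constructor
  · rintro ⟨x, rfl⟩
    by_cases h : ρ x = u
    · simp [h, hu.symm]
    · simp [h]
  · rintro ⟨⟨x, rfl⟩, h⟩
    exact ⟨x, by simp [h]⟩

lemma acy_succ {n k : ℕ} {ρ : Fin n → Fin n}
    (v : Fin (k+1) → Fin n) (u : Fin n) (r : Fin k → Fin n) :
    Acy ρ v (Fin.cons u r : Fin (k+1) → Fin n) ↔
      (u ∈ Set.range ρ ∧ u ≠ ρ (v 0)) ∧ Acy (mrg ρ u (ρ (v 0))) (Fin.tail v) r := by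
  constructor
  · rintro ⟨hinj, hran, h, hh⟩
    have h0 := hh 0
    simp only [Fin.cons_zero] at h0
    have hne : u ≠ ρ (v 0) := by
      intro he; rw [← he] at h0; exact lt_irrefl _ h0
    have hr0 := hran 0
    simp only [Fin.cons_zero] at hr0
    refine ⟨⟨hr0, hne⟩, ?_, ?_, h, ?_⟩
    · intro a b hab
      have := @hinj a.succ b.succ (by simpa using hab)
      exact Fin.succ_injective _ this
    · intro i
      rw [mrg_range hne]
      refine ⟨by simpa using hran i.succ, ?_⟩
      intro he
      have : (i.succ) = 0 := hinj (by simpa using he)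
      exact Fin.succ_ne_zero _ this
    · intro i
      have hi := hh i.succ
      simp only [Fin.cons_succ] at hi
      unfold mrg
      by_cases hc : ρ (Fin.tail v i) = u
      · simp only [hc, if_true]
        have : ρ (v i.succ) = u := hc
        rw [this] at hi
        exact h0.trans hi
      · simp only [hc, if_false]; exact hi
  · rintro ⟨⟨hu, hne⟩, hinj, hran, h, hh⟩
    rw [mrg_range hne] at hran
    refine ⟨?_, ?_, fun x => if x = u then 2 * h (ρ (v 0)) + 1 else 2 * h x, ?_⟩
    · rw [Fin.cons_injective_iff]
      refine ⟨?_, hinj⟩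
      rintro ⟨i, hi⟩
      exact (hran i).2 hi
    · intro i
      refine Fin.cases ?_ (fun i => ?_) i
      · simpa using hu
      · simpa using (hran i).1
    · intro i
      refine Fin.cases ?_ (fun i => ?_) i
      · simp [hne.symm]
      · have hi := hh i
        have h2 : r i ≠ u := (hran i).2
        simp only [Fin.cons_succ, if_neg h2]
        unfold mrg at hi
        by_cases hc : ρ (v i.succ) = u
        · have hc' : ρ (Fin.tail v i) = u := hc
          simp only [hc', if_true] at hi
          simp only [hc, if_true]
          omega
        · have hc' : ρ (Fin.tail v i) ≠ u := hc
          simp only [hc', if_false] at hi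
          simp only [hc, if_false]
          have : h (ρ (v i.succ)) < h (r i) := hi
          omega

lemma card_cons {α : Type*} [Fintype α] {k : ℕ} (P : (Fin (k+1) → α) → Prop) (u : α) :
    {r : Fin (k+1) → α | P r ∧ r 0 = u}.ncard
      = {r : Fin k → α | P (Fin.cons u r)}.ncard := by
  symm
  refine Set.ncard_congr (fun r _ => Fin.cons u r) ?_ ?_ ?_
  · intro r hr
    exact ⟨hr, by simp⟩
  · intro a b _ _ h
    exact (Fin.cons_injective2 h).2
  · rintro r ⟨hr, rfl⟩
    exact ⟨Fin.tail r, by show P _; rw [Fin.cons_self_tail]; exact hr, Fin.cons_self_tail r⟩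

lemma card_acy {n : ℕ} : ∀ (k : ℕ) (ρ : Fin n → Fin n) (_ : ∀ x, ρ (ρ x) = ρ x)
    (v : Fin k → Fin n),
    {r : Fin k → Fin n | Acy ρ v r}.ncard
      = ((Set.range ρ).ncard - 1).descFactorial k := by
  intro k
  induction k with
  | zero =>
    intro ρ hρ v
    have : {r : Fin 0 → Fin n | Acy ρ v r} = Set.univ := by
      ext r
      refine ⟨fun _ => trivial, fun _ => ?_⟩
      exact ⟨fun a => a.elim0, fun a => a.elim0, fun _ => 0, fun a => a.elim0⟩
    rw [this, Set.ncard_univ]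
    simp
  | succ k ih =>
    intro ρ hρ v
    have h1 : {r : Fin (k+1) → Fin n | Acy ρ v r}.ncard
        = ∑ u : Fin n, {r : Fin (k+1) → Fin n | Acy ρ v r ∧ r 0 = u}.ncard := by
      simp only [Set.ncard_eq_toFinset_card', Set.toFinset_ofPred]
      rw [Finset.card_eq_sum_card_fiberwise (f := fun r => r 0) (t := Finset.univ)
        (fun _ _ => Finset.mem_coe.2 (Finset.mem_univ _))]
      refine Finset.sum_congr rfl fun u _ => ?_
      rw [Finset.filter_filter]
    rw [h1]
    have h2 : ∀ u : Fin n, {r : Fin (k+1) → Fin n | Acy ρ v r ∧ r 0 = u}.ncard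
          = if u ∈ Set.range ρ \ {ρ (v 0)} then
              ((Set.range ρ).ncard - 1 - 1).descFactorial k else 0 := by
      intro u
      rw [card_cons]
      simp only [acy_succ]
      split_ifs with h
      · have hne : u ≠ ρ (v 0) := h.2
        simp only [h.1, hne, true_and, ne_eq, not_false_eq_true]
        rw [ih _ (mrg_idem hρ hne), mrg_range hne,
          Set.ncard_sdiff_singleton_of_mem h.1]
      · rw [Set.ncard_eq_zero, Set.eq_empty_iff_forall_notMem]
        rintro r ⟨h', -⟩
        exact h h'
    simp only [h2]
    rw [← Finset.sum_filter, Finset.sum_const, smul_eq_mul]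
    have h3 : (Finset.univ.filter (fun u => u ∈ Set.range ρ \ {ρ (v 0)})).card
        = (Set.range ρ).ncard - 1 := by
      rw [← Set.ncard_sdiff_singleton_of_mem (s := Set.range ρ) (a := ρ (v 0)) ⟨_, rfl⟩,
        ← Set.ncard_coe_finset]
      congr 1
      ext; simp
    rw [h3]
    rcases Nat.eq_zero_or_pos ((Set.range ρ).ncard - 1) with h | h
    · rw [h]; simp
    · obtain ⟨q, hq⟩ := Nat.exists_eq_succ_of_ne_zero h.ne'
      rw [hq, Nat.succ_eq_add_one, Nat.succ_descFactorial_succ]; simp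

lemma acy_perm {n k : ℕ} {ρ : Fin n → Fin n} {v r : Fin k → Fin n}
    (σ : Equiv.Perm (Fin k)) (h : Acy ρ v r) : Acy ρ (v ∘ σ) (r ∘ σ) := by
  obtain ⟨h1, h2, h, h3⟩ := h
  exact ⟨h1.comp σ.injective, fun i => h2 _, h, fun i => h3 _⟩

lemma card_perm {n k : ℕ} (v : Fin k → Fin n) (σ : Equiv.Perm (Fin k))
    (Q : (Fin k → Fin n) → Prop) :
    {r : Fin k → Fin n | Acy id v r ∧ Q (r ∘ σ)}.ncard
    = {r : Fin k → Fin n | Acy id (v ∘ σ) r ∧ Q r}.ncard := by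
  refine Set.ncard_congr (fun r _ => r ∘ σ) ?_ ?_ ?_
  · intro r hr
    exact ⟨acy_perm σ hr.1, hr.2⟩
  · intro a b _ _ h
    exact σ.surjective.injective_comp_right h
  · intro r hr
    have := acy_perm σ.symm hr.1
    refine ⟨r ∘ σ.symm, ⟨?_, ?_⟩, ?_⟩
    · convert this using 1
      ext; simp
    · convert hr.2 using 1
      ext; simp
    · ext; simp

lemma card_G {k : ℕ} (v : Fin k → Fin (k+1)) :
    {r : Fin k → Fin (k+1) | Acy id v r}.ncard = k.factorial := by
  rw [card_acy k id (fun _ => rfl)]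
  simp [Set.range_id, Nat.descFactorial_self]

lemma card_G1 {k : ℕ} (v : Fin (k+1) → Fin (k+2)) (i : Fin (k+1)) (u : Fin (k+2))
    (hu : u ≠ v i) :
    {r : Fin (k+1) → Fin (k+2) | Acy id v r ∧ r i = u}.ncard = k.factorial := by
  have := card_perm v (Equiv.swap 0 i) (fun r => r 0 = u)
  simp only [Function.comp_apply, Equiv.swap_apply_left] at this
  rw [this, card_cons (fun r => Acy id _ r)]
  simp only [acy_succ]
  have hu' : u ≠ id (v i) := hu
  simp only [Function.comp_apply, Equiv.swap_apply_left, Set.range_id, Set.mem_univ, true_and,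
    hu', ne_eq, not_false_eq_true]
  rw [card_acy _ _ (mrg_idem (ρ := id) (fun _ => rfl) hu'), mrg_range hu', Set.range_id,
    Set.ncard_sdiff_singleton_of_mem (Set.mem_univ _)]
  simp [Nat.descFactorial_self]

lemma card_G2 {k : ℕ} (v : Fin (k+2) → Fin (k+3)) (i j : Fin (k+2)) (hij : i ≠ j)
    (u w : Fin (k+3)) :
    {r : Fin (k+2) → Fin (k+3) | Acy id v r ∧ r i = u ∧ r j = w}.ncard ≤ k.factorial := by
  obtain ⟨σ, h0, h1⟩ : ∃ σ : Equiv.Perm (Fin (k+2)), σ 0 = i ∧ σ 1 = j := by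
    refine ⟨(Equiv.swap 0 i) * Equiv.swap 1 ((Equiv.swap 0 i) j), ?_, ?_⟩
    · have : (Equiv.swap 0 i) j ≠ 0 := by
        intro h
        have := congrArg (Equiv.swap 0 i) h
        simp at this
        exact hij this.symm
      rw [Equiv.Perm.mul_apply, Equiv.swap_apply_of_ne_of_ne (by simp) this.symm]
      simp
    · simp
  have := card_perm v σ (fun r => r 0 = u ∧ r 1 = w)
  simp only [Function.comp_apply, h0, h1] at this
  rw [this]
  set v' := v ∘ σ
  have e1 : ∀ r : Fin (k+2) → Fin (k+3), (Acy id v' r ∧ r 0 = u ∧ r 1 = w) ↔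
      ((Acy id v' r ∧ r 1 = w) ∧ r 0 = u) := by intro r; tauto
  simp only [e1]
  rw [card_cons (fun r => Acy id v' r ∧ r 1 = w)]
  simp only [acy_succ]
  by_cases hu : u ≠ id (v' 0)
  swap
  · refine le_of_eq_of_le ((Set.ncard_eq_zero (Set.toFinite _)).2 (Set.eq_empty_iff_forall_notMem.2 ?_))
      (Nat.zero_le _)
    rintro r h
    exact hu h.1.1.2
  have e2 : ∀ r : Fin (k+1) → Fin (k+3),
      (Fin.cons u r : Fin (k+2) → Fin (k+3)) 1 = r 0 := fun r => rfl
  simp only [hu, e2, Set.range_id, Set.mem_univ, true_and, ne_eq, not_false_eq_true]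
  rw [card_cons (fun r => Acy _ _ r)]
  have hid := mrg_idem (ρ := id) (fun _ => rfl) hu
  simp only [acy_succ]
  set ρ := mrg id u (id (v' 0))
  have hcr : (Set.range ρ).ncard = k + 2 := by
    rw [mrg_range hu, Set.range_id, Set.ncard_sdiff_singleton_of_mem (Set.mem_univ _)]
    simp
  by_cases hw : w ∈ Set.range ρ ∧ w ≠ ρ (Fin.tail v' 0)
  swap
  · refine le_of_eq_of_le ((Set.ncard_eq_zero (Set.toFinite _)).2 (Set.eq_empty_iff_forall_notMem.2 ?_))
      (Nat.zero_le _)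
    rintro r h
    exact hw h.1
  simp only [hw, true_and, ne_eq, not_false_eq_true]
  rw [card_acy _ _ (mrg_idem hid hw.2), mrg_range hw.2,
    Set.ncard_sdiff_singleton_of_mem hw.1, hcr]
  simp [Nat.descFactorial_self]

end Forest

section Exec

lemma sameTree_height {n : ℕ} {d : Fin n → ℕ} (E : Path d)
    (hE : IsExecPath d E) : ∀ K : ℕ, K ≤ n - 1 →
    ∃ h : Fin n → ℕ, ∀ j : Fin (n-1), (j : ℕ) < K → h (E j).2.1 < h (E j).1.1 := by
  intro K
  induction K with
  | zero => intro _; exact ⟨fun _ => 0, fun j hj => absurd hj (Nat.not_lt_zero _)⟩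
  | succ K ih =>
    intro hK
    obtain ⟨h, hh⟩ := ih (by omega)
    let k : Fin (n-1) := ⟨K, by omega⟩
    have hns := (hE k).2.2.2.2
    refine ⟨fun x => h x + if SameTree E k (E k).1.1 x then h (E k).2.1 + 1 else 0, ?_⟩
    intro j hj
    by_cases hjK : (j : ℕ) < K
    · have hjk : j < k := hjK
      have e : SameTree E k (E k).1.1 (E j).2.1 ↔ SameTree E k (E k).1.1 (E j).1.1 := by
        constructor
        · intro hs
          exact Relation.ReflTransGen.tail hs ⟨j, hjk, Or.inr ⟨rfl, rfl⟩⟩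
        · intro hs
          exact Relation.ReflTransGen.tail hs ⟨j, hjk, Or.inl ⟨rfl, rfl⟩⟩
      have := hh j hjK
      simp only [e]
      omega
    · have : j = k := Fin.ext (by simp [k]; omega)
      rw [this]
      have hr : SameTree E k (E k).1.1 (E k).1.1 := Relation.ReflTransGen.refl
      simp only [hns, hr, if_true, if_false]
      omega

lemma not_sameTree {n : ℕ} {d : Fin n → ℕ} (E : Path d)
    (hinj : Function.Injective (fun k => (E k).1.1)) (h : Fin n → ℕ)
    (hh : ∀ j, h (E j).2.1 < h (E j).1.1) (k : Fin (n-1)) :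
    ¬ SameTree E k (E k).1.1 (E k).2.1 := by
  intro hs
  let D : Fin n → Fin n → Prop := fun x y => ∃ j, j < k ∧ (E j).1.1 = x ∧ (E j).2.1 = y
  have key : ∀ a, SameTree E k (E k).1.1 a → Relation.ReflTransGen D a (E k).1.1 := by
    intro a ha
    induction ha with
    | refl => exact Relation.ReflTransGen.refl
    | tail hab hbc ih =>
      rename_i b c
      obtain ⟨j, hj, h1 | h1⟩ := hbc
      · -- edge b → c
        rcases Relation.ReflTransGen.cases_head ih with he | ⟨e, hbe, hec⟩
        · exfalso
          have : j = k := hinj (h1.1.trans he)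
          exact absurd hj (by rw [this]; exact lt_irrefl _)
        · obtain ⟨j', hj', h2, h3⟩ := hbe
          have : j = j' := hinj (h1.1.trans h2.symm)
          subst this
          rw [← h1.2, h3]; exact hec
      · exact Relation.ReflTransGen.head ⟨j, hj, h1.1, h1.2⟩ ih
  have mono : ∀ a b, Relation.ReflTransGen D a b → h b ≤ h a := by
    intro a b hab
    induction hab with
    | refl => exact le_rfl
    | tail _ hbc ih =>
      obtain ⟨j, _, h1, h2⟩ := hbc
      have := hh j
      rw [h1, h2] at this
      omega
  have := mono _ _ (key _ hs)
  have := hh k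
  omega

lemma exec_iff {n : ℕ} {d : Fin n → ℕ} (E : Path d) :
    IsExecPath d E ↔ (∀ k, IsRootHE d (E k).1) ∧ (∀ k, IsNonRootHE d (E k).2) ∧
      Function.Injective (fun k => (E k).2) ∧
      Acy id (fun k => (E k).2.1) (fun k => (E k).1.1) := by
  constructor
  · intro hE
    obtain ⟨h, hh⟩ := sameTree_height E hE (n-1) le_rfl
    refine ⟨fun k => (hE k).1, fun k => (hE k).2.1, ?_, ?_, fun i => ⟨_, rfl⟩, h,
      fun j => hh j j.2⟩
    · intro a b hab
      rcases lt_trichotomy a b with hl | he | hl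
      · exact absurd hab ((hE b).2.2.2.1 a hl)
      · exact he
      · exact absurd hab.symm ((hE a).2.2.2.1 b hl)
    · have aux : ∀ a b, (E a).1.1 = (E b).1.1 → (E a).1 = (E b).1 := by
        intro a b hab
        have h1 := (hE a).1
        have h2 := (hE b).1
        unfold IsRootHE at h1 h2
        generalize (E a).1 = x at *
        generalize (E b).1 = y at *
        obtain ⟨x1, x2⟩ := x
        obtain ⟨y1, y2⟩ := y
        simp only at hab
        subst hab
        congr 1
        exact Fin.ext (h1.trans h2.symm)
      intro a b hab
      have hab' := aux a b hab
      rcases lt_trichotomy a b with hl | he | hl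
      · exact absurd hab' ((hE b).2.2.1 a hl)
      · exact he
      · exact absurd hab'.symm ((hE a).2.2.1 b hl)
  · rintro ⟨h1, h2, h3, h4, -, h, hh⟩ k
    refine ⟨h1 k, h2 k, ?_, ?_, not_sameTree E h4 h hh k⟩
    · intro j hj he
      exact hj.ne (h4 (congrArg Sigma.fst he))
    · intro j hj he
      exact hj.ne (h3 he)

/-- The non-root half-edges. -/
abbrev NR {n : ℕ} (d : Fin n → ℕ) := {h : HE d // IsNonRootHE d h}

/-- Rebuild a path from its non-root half-edges and its root vertices. -/
def mkPath {n : ℕ} {d : Fin n → ℕ} (hd : ∀ i, 1 ≤ d i) (s : Fin (n-1) ↪ NR d)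
    (r : Fin (n-1) → Fin n) : Path d :=
  fun k => (⟨r k, ⟨d (r k) - 1, by have := hd (r k); omega⟩⟩, (s k).1)

/-- The parent vertices. -/
def pv {n : ℕ} {d : Fin n → ℕ} (s : Fin (n-1) ↪ NR d) : Fin (n-1) → Fin n :=
  fun k => (s k).1.1

lemma mkPath_exec {n : ℕ} {d : Fin n → ℕ} (hd : ∀ i, 1 ≤ d i) (s : Fin (n-1) ↪ NR d)
    (r : Fin (n-1) → Fin n) : IsExecPath d (mkPath hd s r) ↔ Acy id (pv s) r := by
  rw [exec_iff]
  constructor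
  · exact fun h => h.2.2.2
  · intro h
    refine ⟨fun k => rfl, fun k => (s k).2, ?_, h⟩
    intro a b hab
    exact s.injective (Subtype.ext hab)

lemma root_eq {n : ℕ} {d : Fin n → ℕ} (hd : ∀ i, 1 ≤ d i) (x : HE d) (h : IsRootHE d x) :
    (⟨x.1, ⟨d x.1 - 1, by have := hd x.1; omega⟩⟩ : HE d) = x := by
  obtain ⟨x1, x2⟩ := x
  congr 1
  exact Fin.ext h.symm

lemma exec_sum {n : ℕ} {d : Fin n → ℕ} (hd : ∀ i, 1 ≤ d i) (F : Path d → ℝ) :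
    ∑ E ∈ Finset.univ.filter (fun E => IsExecPath d E), F E =
      ∑ s : Fin (n-1) ↪ NR d, ∑ r ∈ Finset.univ.filter
        (fun r : Fin (n-1) → Fin n => Acy id (pv s) r), F (mkPath hd s r) := by
  rw [Finset.sum_sigma']
  symm
  refine Finset.sum_bij (fun x _ => mkPath hd x.1 x.2) ?_ ?_ ?_ ?_
  · intro x hx
    simp only [Finset.mem_sigma, Finset.mem_univ, true_and, Finset.mem_filter] at hx ⊢
    exact (mkPath_exec hd _ _).2 hx
  · rintro ⟨s, r⟩ _ ⟨s', r'⟩ _ he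
    have e1 : s = s' := by
      ext k : 1
      exact Subtype.ext (congrArg Prod.snd (congrFun he k))
    have e2 : r = r' := by
      ext k : 1
      exact congrArg (fun x => x.1.1) (congrFun he k)
    rw [e1, e2]
  · intro E hE
    simp only [Finset.mem_univ, true_and, Finset.mem_filter] at hE
    have h := (exec_iff E).1 hE
    refine ⟨⟨⟨fun k => ⟨(E k).2, h.2.1 k⟩, ?_⟩, fun k => (E k).1.1⟩, ?_, ?_⟩
    · intro a b hab
      exact h.2.2.1 (congrArg Subtype.val hab)
    · simp only [Finset.mem_sigma, Finset.mem_univ, true_and, Finset.mem_filter]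
      exact h.2.2.2
    · funext k
      refine Prod.ext ?_ rfl
      have h1 := h.1 k
      exact root_eq hd _ h1
  · intro x _; rfl

/-- Child counts in terms of `s`. -/
noncomputable def cs {n : ℕ} {d : Fin n → ℕ} (s : Fin (n-1) ↪ NR d) (i : Fin n) : ℕ :=
  (Finset.univ.filter (fun k => (s k).1.1 = i)).card

/-- vertices with degree `b` and `a` children -/
noncomputable def VS {n : ℕ} {d : Fin n → ℕ} (s : Fin (n-1) ↪ NR d) (b a : ℕ) : Finset (Fin n) :=
  Finset.univ.filter (fun i => d i = b ∧ cs s i = a)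

lemma Rcount_mkPath {n : ℕ} {d : Fin n → ℕ} (hd : ∀ i, 1 ≤ d i) (s : Fin (n-1) ↪ NR d)
    (r : Fin (n-1) → Fin n) (hr : Acy id (pv s) r) (b₁ b₂ a₁ a₂ : ℕ) :
    Rcount (mkPath hd s r) b₁ b₂ a₁ a₂ =
      ((Finset.univ.filter (fun k => pv s k ∈ VS s b₂ a₂)).filter
        (fun k => r k ∈ VS s b₁ a₁)).card := by
  have hcc : ∀ i, cc (mkPath hd s r) i = cs s i := by
    intro i
    unfold cc cs
    rw [Nat.card_eq_fintype_card, Fintype.card_subtype]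
    rfl
  have hpar : ∀ k, parentOf (mkPath hd s r) (r k) = pv s k := by
    intro k
    unfold parentOf
    have hex : ∃ k', ((mkPath hd s r) k').1.1 = r k := ⟨k, rfl⟩
    rw [dif_pos hex]
    have : hex.choose = k := hr.1 hex.choose_spec
    rw [this]; rfl
  unfold Rcount
  rw [Nat.card_eq_fintype_card, Fintype.card_subtype]
  symm
  refine Finset.card_bij (fun k _ => r k) ?_ ?_ ?_
  · intro k hk
    simp only [VS, Finset.mem_filter, Finset.mem_univ, true_and] at hk ⊢
    rw [hpar, hcc, hcc]
    exact ⟨⟨k, rfl⟩, hk.2.1, hk.1.1, hk.2.2, hk.1.2⟩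
  · intro a _ b _ h
    exact hr.1 h
  · intro u hu
    simp only [VS, Finset.mem_filter, Finset.mem_univ, true_and] at hu ⊢
    obtain ⟨⟨k, hk⟩, h2, h3, h4, h5⟩ := hu
    have hk' : r k = u := hk
    subst hk'
    rw [hpar] at h3 h5
    rw [hcc] at h4 h5
    exact ⟨k, ⟨⟨h3, h5⟩, h2, h4⟩, rfl⟩

lemma card_I {n : ℕ} {d : Fin n → ℕ} (s : Fin (n-1) ↪ NR d) (b a : ℕ) :
    (Finset.univ.filter (fun k => pv s k ∈ VS s b a)).card = a * (VS s b a).card := by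
  rw [Finset.card_eq_sum_card_fiberwise (f := pv s) (t := VS s b a)
    (fun k hk => by simpa using hk)]
  rw [Finset.sum_congr rfl (g := fun _ => a), Finset.sum_const, smul_eq_mul, mul_comm]
  intro i hi
  rw [Finset.filter_filter]
  have h2 : cs s i = a := by
    simp only [VS, Finset.mem_filter] at hi
    exact hi.2.2
  refine Eq.trans ?_ h2
  unfold cs
  congr 1
  ext k
  simp only [Finset.mem_filter, Finset.mem_univ, true_and]
  constructor
  · exact fun h => h.2
  · intro h
    have h' : pv s k = i := h
    exact ⟨by rw [h']; exact hi, h⟩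

end Exec

section CondVar

lemma arith_var (m i y : ℝ) (hm : 2 ≤ m) (hi0 : 0 ≤ i) (him : i ≤ m) (hy0 : 0 ≤ y)
    (hy1 : y ≤ 1) :
    i * (m * (m-1)) + i^2 * (y * (m+1))^2 - 2 * (i * y) * (i * ((y * (m+1) - 1) * (m-1)))
      + (i*y)^2 * (m*(m-1)) ≤ 8 * (m+1) * (m * (m-1)) := by
  have e : i * (m * (m-1)) + i^2 * (y * (m+1))^2
      - 2 * (i * y) * (i * ((y * (m+1) - 1) * (m-1)))
      + (i*y)^2 * (m*(m-1)) = i * (m*(m-1)) + i^2*y^2*(m+3) + 2*(i^2*y*(m-1)) := by ring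
  rw [e]
  have h1 : i * (m*(m-1)) ≤ m * (m*(m-1)) :=
    mul_le_mul_of_nonneg_right him (mul_nonneg (by linarith) (by linarith))
  have hi2 : i^2 ≤ m^2 := pow_le_pow_left₀ hi0 him 2
  have hy2 : y^2 ≤ 1 := pow_le_one₀ hy0 hy1
  have h2 : i^2*y^2*(m+3) ≤ m^2*1*(m+3) := by
    apply mul_le_mul_of_nonneg_right _ (by linarith)
    exact mul_le_mul hi2 hy2 (sq_nonneg _) (sq_nonneg _)
  have h3 : i^2*y*(m-1) ≤ m^2*1*(m-1) := by
    apply mul_le_mul_of_nonneg_right _ (by linarith)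
    exact mul_le_mul hi2 hy1 hy0 (sq_nonneg _)
  nlinarith [mul_nonneg (sub_nonneg.2 hm) (sub_nonneg.2 hm),
    mul_nonneg (mul_nonneg (sub_nonneg.2 hm) (sub_nonneg.2 hm)) (sub_nonneg.2 hm)]

lemma condVar {k : ℕ} (v : Fin (k+2) → Fin (k+3)) (I : Finset (Fin (k+2)))
    (A : Finset (Fin (k+3))) :
    ∑ r ∈ Finset.univ.filter (fun r : Fin (k+2) → Fin (k+3) => Acy id v r),
      (((I.filter (fun i => r i ∈ A)).card : ℝ)
        - (I.card : ℝ) * (A.card : ℝ) / ((k+3 : ℕ) : ℝ))^2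
      ≤ 8 * ((k+3 : ℕ) : ℝ) * ((k+2).factorial : ℝ) := by
  set G := Finset.univ.filter (fun r : Fin (k+2) → Fin (k+3) => Acy id v r) with hG
  have hGc : (G.card : ℝ) = ((k+2).factorial : ℝ) := by
    rw [← card_G v, ← Set.ncard_coe_finset]
    congr 2
    ext; simp [hG]
  have hX : ∀ r : Fin (k+2) → Fin (k+3), ((I.filter (fun i => r i ∈ A)).card : ℝ)
      = ∑ i ∈ I, if r i ∈ A then (1:ℝ) else 0 := by
    intro r; simp
  have hind : ∀ (r : Fin (k+2) → Fin (k+3)) (i : Fin (k+2)), (if r i ∈ A then (1:ℝ) else 0)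
      = ∑ u ∈ A, if r i = u then (1:ℝ) else 0 := by
    intro r i; simp
  have hc1 : ∀ i u, ∑ r ∈ G, (if r i = u then (1:ℝ) else 0)
      = ({r : Fin (k+2) → Fin (k+3) | Acy id v r ∧ r i = u}.ncard : ℝ) := by
    intro i u
    rw [← Finset.sum_filter, Finset.sum_const, nsmul_eq_mul, mul_one, hG, Finset.filter_filter,
      ← Set.ncard_coe_finset]
    congr 2
    ext; simp
  have hc2 : ∀ i j u w, ∑ r ∈ G, (if r i = u then (1:ℝ) else 0) * (if r j = w then (1:ℝ) else 0)
      = ({r : Fin (k+2) → Fin (k+3) | Acy id v r ∧ r i = u ∧ r j = w}.ncard : ℝ) := by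
    intro i j u w
    simp only [← ite_and, mul_ite, mul_one, mul_zero]
    rw [← Finset.sum_filter, Finset.sum_const, nsmul_eq_mul, mul_one, hG, Finset.filter_filter,
      ← Set.ncard_coe_finset]
    congr 2
    ext; simp [and_comm]
  have hS1 : (I.card : ℝ) * (((A.card : ℝ) - 1) * ((k+1).factorial : ℝ))
      ≤ ∑ r ∈ G, ((I.filter (fun i => r i ∈ A)).card : ℝ) := by
    simp only [hX, hind]
    rw [Finset.sum_comm, ← nsmul_eq_mul, ← Finset.sum_const]
    refine Finset.sum_le_sum fun i _ => ?_
    rw [Finset.sum_comm]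
    simp only [hc1]
    calc ((A.card : ℝ) - 1) * ((k+1).factorial : ℝ)
        ≤ ((A.erase (v i)).card : ℝ) * ((k+1).factorial : ℝ) := by
          apply mul_le_mul_of_nonneg_right _ (Nat.cast_nonneg _)
          have : A.card - 1 ≤ (A.erase (v i)).card := Finset.pred_card_le_card_erase
          have h2 : A.card ≤ (A.erase (v i)).card + 1 := by omega
          have h3 : (A.card : ℝ) ≤ ((A.erase (v i)).card : ℝ) + 1 := by exact_mod_cast h2
          linarith
      _ = ∑ u ∈ A.erase (v i), ((k+1).factorial : ℝ) := by simp
      _ = ∑ u ∈ A.erase (v i),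
            ({r : Fin (k+2) → Fin (k+3) | Acy id v r ∧ r i = u}.ncard : ℝ) := by
          refine Finset.sum_congr rfl fun u hu => ?_
          rw [card_G1 v i u (Finset.ne_of_mem_erase hu)]
      _ ≤ _ := Finset.sum_le_sum_of_subset_of_nonneg (Finset.erase_subset _ _)
          (fun _ _ _ => Nat.cast_nonneg _)
  have hS2 : ∑ r ∈ G, ((I.filter (fun i => r i ∈ A)).card : ℝ)^2
      ≤ (I.card : ℝ) * ((k+2).factorial : ℝ)
        + (I.card : ℝ)^2 * (A.card : ℝ)^2 * (k.factorial : ℝ) := by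
    simp only [hX, sq, Finset.sum_mul_sum]
    rw [Finset.sum_comm]
    calc ∑ i ∈ I, ∑ r ∈ G, ∑ j ∈ I,
          (if r i ∈ A then (1:ℝ) else 0) * (if r j ∈ A then (1:ℝ) else 0)
        ≤ ∑ i ∈ I, ∑ j ∈ I, ((if i = j then ((k+2).factorial : ℝ) else 0)
            + (A.card : ℝ) * (A.card : ℝ) * (k.factorial : ℝ)) := by
          refine Finset.sum_le_sum fun i _ => ?_
          rw [Finset.sum_comm]
          refine Finset.sum_le_sum fun j _ => ?_
          by_cases hij : i = j
          · rw [if_pos hij]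
            have : ∑ r ∈ G, (if r i ∈ A then (1:ℝ) else 0) * (if r j ∈ A then (1:ℝ) else 0)
                ≤ ∑ r ∈ G, (1:ℝ) := by
              refine Finset.sum_le_sum fun r _ => ?_
              split_ifs <;> norm_num
            rw [Finset.sum_const, nsmul_eq_mul, mul_one, hGc] at this
            have : 0 ≤ (A.card : ℝ) * (A.card : ℝ) * (k.factorial : ℝ) := by positivity
            linarith
          · rw [if_neg hij, zero_add]
            simp only [hind, Finset.sum_mul_sum]
            rw [Finset.sum_comm, mul_assoc, ← nsmul_eq_mul, ← Finset.sum_const]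
            refine Finset.sum_le_sum fun u _ => ?_
            rw [Finset.sum_comm, ← nsmul_eq_mul, ← Finset.sum_const]
            refine Finset.sum_le_sum fun w _ => ?_
            rw [hc2]
            exact_mod_cast card_G2 v i j hij u w
      _ = _ := by
          simp only [Finset.sum_add_distrib, Finset.sum_const, nsmul_eq_mul, Finset.sum_ite_eq]
          rw [Finset.sum_congr rfl (g := fun _ => ((k+2).factorial : ℝ))
            (fun x hx => by simp [hx])]
          simp only [Finset.sum_const, nsmul_eq_mul]
          ring
  set x : ℝ := (I.card : ℝ) * (A.card : ℝ) / ((k+3 : ℕ) : ℝ) with hx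
  have hx0 : 0 ≤ x := by positivity
  have hexp : ∑ r ∈ G, (((I.filter (fun i => r i ∈ A)).card : ℝ) - x)^2
      = ∑ r ∈ G, ((I.filter (fun i => r i ∈ A)).card : ℝ)^2
        - 2 * x * (∑ r ∈ G, ((I.filter (fun i => r i ∈ A)).card : ℝ))
        + x^2 * ((k+2).factorial : ℝ) := by
    rw [← hGc, Finset.mul_sum, ← Finset.sum_sub_distrib]
    have : x^2 * (G.card : ℝ) = ∑ r ∈ G, x^2 := by simp [mul_comm]
    rw [this, ← Finset.sum_add_distrib]
    refine Finset.sum_congr rfl fun r _ => by ring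
  rw [hexp]
  have h5 := mul_le_mul_of_nonneg_left hS1 (by positivity : 0 ≤ 2 * x)
  have hI : I.card ≤ k + 2 := by simpa using Finset.card_le_univ I
  have hA : A.card ≤ k + 3 := by simpa using Finset.card_le_univ A
  have hIr : (I.card : ℝ) ≤ (k:ℝ) + 2 := by exact_mod_cast hI
  have hAr : (A.card : ℝ) ≤ ((k+3 : ℕ) : ℝ) := by exact_mod_cast hA
  have hn0 : (0:ℝ) < ((k+3 : ℕ) : ℝ) := by positivity
  have har := arith_var ((k:ℝ)+2) I.card ((A.card : ℝ) / ((k+3 : ℕ) : ℝ))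
    (by have : (0:ℝ) ≤ k := Nat.cast_nonneg k
        linarith) (Nat.cast_nonneg _) hIr (by positivity)
    ((div_le_one hn0).2 hAr)
  have e1 : (A.card : ℝ) / ((k+3 : ℕ) : ℝ) * ((k:ℝ)+2+1) = A.card := by
    push_cast
    have : (k:ℝ)+3 ≠ 0 := by positivity
    field_simp
    ring
  have e2 : (I.card : ℝ) * ((A.card : ℝ) / ((k+3 : ℕ) : ℝ)) = x := by rw [hx]; ring
  rw [e1, e2] at har
  have hf := mul_le_mul_of_nonneg_right har (Nat.cast_nonneg (α := ℝ) k.factorial)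
  have f2 : ((k+2).factorial : ℝ) = ((k:ℝ)+2) * ((k:ℝ)+1) * (k.factorial : ℝ) := by
    rw [Nat.factorial_succ, Nat.factorial_succ]; push_cast; ring
  have f1 : ((k+1).factorial : ℝ) = ((k:ℝ)+1) * (k.factorial : ℝ) := by
    rw [Nat.factorial_succ]; push_cast; ring
  rw [f2] at hS2 ⊢
  rw [f1] at h5
  push_cast
  have e3 : (k:ℝ) + 2 - 1 = k + 1 := by ring
  have e4 : (k:ℝ) + 2 + 1 = k + 3 := by ring
  rw [e3, e4] at hf
  nlinarith [hf, h5, hS2]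

lemma condVar' {n : ℕ} (hn : 3 ≤ n) (v : Fin (n-1) → Fin n) (I : Finset (Fin (n-1)))
    (A : Finset (Fin n)) :
    ∑ r ∈ Finset.univ.filter (fun r : Fin (n-1) → Fin n => Acy id v r),
      (((I.filter (fun i => r i ∈ A)).card : ℝ)
        - (I.card : ℝ) * (A.card : ℝ) / (n : ℝ))^2
      ≤ 8 * (n : ℝ) * ((n-1).factorial : ℝ) := by
  obtain ⟨k, rfl⟩ : ∃ k, n = k + 3 := ⟨n - 3, by omega⟩
  exact condVar v I A

lemma card_G' {n : ℕ} (hn : 1 ≤ n) (v : Fin (n-1) → Fin n) :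
    ((Finset.univ.filter (fun r : Fin (n-1) → Fin n => Acy id v r)).card : ℝ)
      = ((n-1).factorial : ℝ) := by
  obtain ⟨k, rfl⟩ : ∃ k, n = k + 1 := ⟨n - 1, by omega⟩
  have := card_G v
  simp only [Nat.add_sub_cancel] at *
  rw [← this, ← Set.ncard_coe_finset]
  congr 2
  ext; simp

end CondVar

section Hyper

lemma card_split {H : Type*} [Fintype H] [DecidableEq H] (D₁ D₂ : Finset H) (hD : Disjoint D₁ D₂)
    (m a₁ a₂ : ℕ) (ha : a₁ + a₂ ≤ m) :
    ((Finset.powersetCard m (Finset.univ : Finset H)).filter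
      (fun T => (T ∩ D₁).card = a₁ ∧ (T ∩ D₂).card = a₂)).card
      = D₁.card.choose a₁ * D₂.card.choose a₂
        * (Fintype.card H - (D₁.card + D₂.card)).choose (m - (a₁ + a₂)) := by
  have hc : (Finset.univ \ (D₁ ∪ D₂)).card = Fintype.card H - (D₁.card + D₂.card) := by
    rw [Finset.card_sdiff_of_subset (Finset.subset_univ _), Finset.card_union_of_disjoint hD,
      Finset.card_univ]
  rw [← hc, ← Finset.card_powersetCard, ← Finset.card_powersetCard, ← Finset.card_powersetCard,
    ← Finset.card_product, ← Finset.card_product]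
  have hd' : ∀ x, x ∈ D₁ → x ∉ D₂ := fun x h1 h2 => Finset.disjoint_left.1 hD h1 h2
  refine Finset.card_bij' (fun T _ => ((T ∩ D₁, T ∩ D₂), T \ (D₁ ∪ D₂)))
    (fun P _ => P.1.1 ∪ P.1.2 ∪ P.2) ?_ ?_ ?_ ?_
  · intro T hT
    simp only [Finset.mem_filter, Finset.mem_powersetCard, Finset.mem_product] at hT ⊢
    refine ⟨⟨⟨Finset.inter_subset_right, hT.2.1⟩, ⟨Finset.inter_subset_right, hT.2.2⟩⟩,
      Finset.sdiff_subset_sdiff (Finset.subset_univ _) le_rfl, ?_⟩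
    have h1 := Finset.card_sdiff_add_card_inter T (D₁ ∪ D₂)
    rw [Finset.inter_union_distrib_left, Finset.card_union_of_disjoint, hT.2.1, hT.2.2,
      hT.1.2] at h1
    · omega
    · exact hD.mono Finset.inter_subset_right Finset.inter_subset_right
  · rintro ⟨⟨X, Y⟩, Z⟩ hP
    simp only [Finset.mem_filter, Finset.mem_powersetCard, Finset.mem_product] at hP ⊢
    obtain ⟨⟨⟨hX, hXc⟩, ⟨hY, hYc⟩⟩, hZ, hZc⟩ := hP
    have hZ' : ∀ x ∈ Z, x ∉ D₁ ∧ x ∉ D₂ := by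
      intro x hx
      have := hZ hx
      simpa using this
    refine ⟨⟨Finset.subset_univ _, ?_⟩, ?_, ?_⟩
    · rw [Finset.card_union_of_disjoint, Finset.card_union_of_disjoint, hXc, hYc, hZc]
      · omega
      · exact hD.mono hX hY
      · rw [Finset.disjoint_left]
        intro x hx hxZ
        rcases Finset.mem_union.1 hx with h | h
        · exact (hZ' x hxZ).1 (hX h)
        · exact (hZ' x hxZ).2 (hY h)
    · rw [← hXc]
      congr 1
      ext x
      have := @hX x; have := @hY x; have := hZ' x; have := hd' x
      simp only [Finset.mem_inter, Finset.mem_union]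
      tauto
    · rw [← hYc]
      congr 1
      ext x
      have := @hX x; have := @hY x; have := hZ' x; have := hd' x
      simp only [Finset.mem_inter, Finset.mem_union]
      tauto
  · intro T hT
    ext x
    simp only [Finset.mem_inter, Finset.mem_union, Finset.mem_sdiff]
    tauto
  · rintro ⟨⟨X, Y⟩, Z⟩ hP
    simp only [Finset.mem_powersetCard, Finset.mem_product] at hP
    obtain ⟨⟨⟨hX, hXc⟩, ⟨hY, hYc⟩⟩, hZ, hZc⟩ := hP
    have hZ' : ∀ x ∈ Z, x ∉ D₁ ∧ x ∉ D₂ := by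
      intro x hx
      have := hZ hx
      simpa using this
    refine Prod.ext (Prod.ext ?_ ?_) ?_
    all_goals
      ext x
      have := @hX x; have := @hY x; have := hZ' x; have := hd' x
      simp only [Finset.mem_inter, Finset.mem_union, Finset.mem_sdiff]
      tauto

lemma card_emb_fiber {H : Type*} [Fintype H] {m : ℕ} (T : Finset H) (hT : T.card = m) :
    (Finset.univ.filter (fun s : Fin m ↪ H => Finset.univ.map s = T)).card = m.factorial := by
  have e : (Fin m ≃ T) ≃ {s : Fin m ↪ H // Finset.univ.map s = T} :=
    { toFun := fun f => ⟨f.toEmbedding.trans (Function.Embedding.subtype _), by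
        ext x
        simp only [Finset.mem_map, Finset.mem_univ, true_and]
        constructor
        · rintro ⟨i, rfl⟩
          exact (f i).2
        · intro hx
          exact ⟨f.symm ⟨x, hx⟩, by simp⟩⟩
      invFun := fun s => Equiv.ofBijective
        (fun i => (⟨s.1 i, by
          have h : s.1 i ∈ Finset.univ.map s.1 := by simp
          exact (Finset.ext_iff.1 s.2 _).1 h⟩ : T)) (by
          constructor
          · intro a b hab
            exact s.1.injective (congrArg Subtype.val hab)
          · rintro ⟨x, hx⟩
            replace hx := (Finset.ext_iff.1 s.2 _).2 hx
            simp only [Finset.mem_map, Finset.mem_univ, true_and] at hx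
            obtain ⟨i, hi⟩ := hx
            exact ⟨i, Subtype.ext hi⟩)
      left_inv := fun f => by ext; rfl
      right_inv := fun s => by ext; rfl }
  rw [← Fintype.card_subtype, ← Fintype.card_congr e,
    Fintype.card_equiv (Fintype.equivFinOfCardEq (by simpa using hT)).symm, Fintype.card_fin]

lemma sum_emb {H : Type*} [Fintype H] {m : ℕ} (Q : Finset H → Prop) [DecidablePred Q]
    [DecidablePred (fun s : Fin m ↪ H => Q (Finset.univ.map s))] :
    (Finset.univ.filter (fun s : Fin m ↪ H => Q (Finset.univ.map s))).card
      = m.factorial * ((Finset.powersetCard m (Finset.univ : Finset H)).filter Q).card := by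
  rw [Finset.card_eq_sum_card_fiberwise (f := fun s : Fin m ↪ H => Finset.univ.map s)
    (t := (Finset.powersetCard m (Finset.univ : Finset H)).filter Q)]
  · rw [Finset.sum_congr rfl (g := fun _ => m.factorial), Finset.sum_const, smul_eq_mul, mul_comm]
    intro T hT
    simp only [Finset.mem_filter, Finset.mem_powersetCard] at hT
    rw [← card_emb_fiber T hT.1.2, Finset.filter_filter]
    congr 1
    ext s
    simp only [Finset.mem_filter, Finset.mem_univ, true_and]
    constructor
    · exact fun h => h.2
    · intro h; exact ⟨by rw [h]; exact hT.2, h⟩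
  · intro s hs
    simp only [Finset.coe_filter, Finset.mem_powersetCard, Finset.mem_univ, true_and,
      Set.mem_ofPred_eq] at hs ⊢
    exact ⟨⟨Finset.subset_univ _, by simp⟩, hs⟩

/-- Non-root half-edges at `v`. -/
noncomputable def DV {n : ℕ} (d : Fin n → ℕ) (v : Fin n) : Finset (NR d) :=
  Finset.univ.filter (fun h => h.1.1 = v)

lemma card_DV {n : ℕ} (d : Fin n → ℕ) (v : Fin n) : (DV d v).card = d v - 1 := by
  have : (DV d v).card = (Finset.univ : Finset (Fin (d v - 1))).card := by
    symm
    refine Finset.card_bij (fun j _ => ⟨⟨v, ⟨j, by omega⟩⟩, by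
      show (j : ℕ) < d v - 1; exact j.2⟩) ?_ ?_ ?_
    · intro j _
      simp [DV]
    · intro a _ b _ hab
      simp at hab
      exact Fin.ext hab
    · rintro ⟨⟨w, j⟩, hj⟩ hb
      simp only [DV, Finset.mem_filter, Finset.mem_univ, true_and] at hb
      subst hb
      exact ⟨⟨j, hj⟩, Finset.mem_univ _, rfl⟩
  simpa using this

lemma card_NR {n : ℕ} (d : Fin n → ℕ) : Fintype.card (NR d) = ∑ v, (d v - 1) := by
  rw [← Finset.card_univ, Finset.card_eq_sum_card_fiberwise (f := fun h : NR d => h.1.1)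
    (t := Finset.univ) (fun _ _ => Finset.mem_coe.2 (Finset.mem_univ _))]
  refine Finset.sum_congr rfl fun v _ => card_DV d v

lemma cs_eq {n : ℕ} {d : Fin n → ℕ} (s : Fin (n-1) ↪ NR d) (v : Fin n) :
    cs s v = ((Finset.univ.map s) ∩ DV d v).card := by
  unfold cs
  rw [← Finset.card_map s]
  congr 1
  ext x
  simp only [Finset.mem_map, Finset.mem_filter, Finset.mem_univ, true_and, DV, Finset.mem_inter]
  constructor
  · rintro ⟨k, h1, rfl⟩
    exact ⟨⟨k, rfl⟩, h1⟩
  · rintro ⟨⟨k, rfl⟩, h1⟩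
    exact ⟨k, h1, rfl⟩

lemma count1 {n : ℕ} {d : Fin n → ℕ} (v : Fin n) (a : ℕ) (ha : a ≤ n - 1) :
    (Finset.univ.filter (fun s : Fin (n-1) ↪ NR d => cs s v = a)).card
      = (n-1).factorial * ((d v - 1).choose a
        * (Fintype.card (NR d) - (d v - 1)).choose (n - 1 - a)) := by
  simp only [cs_eq]
  rw [sum_emb (fun T => (T ∩ DV d v).card = a)]
  have := card_split (DV d v) ∅ (Finset.disjoint_empty_right _) (n-1) a 0 (by simpa using ha)
  simp only [Finset.inter_empty, Finset.card_empty, and_true, card_DV, Nat.choose_zero_right,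
    mul_one, add_zero] at this
  rw [this]

lemma count2 {n : ℕ} {d : Fin n → ℕ} (v w : Fin n) (hvw : v ≠ w) (a : ℕ) (ha : a + a ≤ n - 1) :
    (Finset.univ.filter (fun s : Fin (n-1) ↪ NR d => cs s v = a ∧ cs s w = a)).card
      = (n-1).factorial * ((d v - 1).choose a * (d w - 1).choose a
        * (Fintype.card (NR d) - ((d v - 1) + (d w - 1))).choose (n - 1 - (a + a))) := by
  simp only [cs_eq]
  rw [sum_emb (fun T => (T ∩ DV d v).card = a ∧ (T ∩ DV d w).card = a)]
  have hdis : Disjoint (DV d v) (DV d w) := by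
    rw [Finset.disjoint_left]
    intro x hx hy
    simp only [DV, Finset.mem_filter, Finset.mem_univ, true_and] at hx hy
    exact hvw (hx.symm.trans hy)
  have := card_split (DV d v) (DV d w) hdis (n-1) a a ha
  simp only [card_DV] at this
  rw [this]

lemma sum_VS {n : ℕ} {d : Fin n → ℕ} (b a : ℕ) (ha : a ≤ n - 1) :
    ∑ s : Fin (n-1) ↪ NR d, ((VS s b a).card : ℝ)
      = ((Finset.univ.filter (fun i => d i = b)).card : ℝ) *
        (((n-1).factorial : ℝ) * (((b - 1).choose a : ℝ)
        * ((Fintype.card (NR d) - (b - 1)).choose (n - 1 - a) : ℝ))) := by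
  have h1 : ∀ s : Fin (n-1) ↪ NR d, ((VS s b a).card : ℝ)
      = ∑ i ∈ Finset.univ.filter (fun i => d i = b), if cs s i = a then (1:ℝ) else 0 := by
    intro s
    rw [← Finset.sum_filter, Finset.filter_filter]
    simp [VS]
  simp only [h1]
  rw [Finset.sum_comm, ← nsmul_eq_mul, ← Finset.sum_const]
  refine Finset.sum_congr rfl fun i hi => ?_
  simp only [Finset.mem_filter, Finset.mem_univ, true_and] at hi
  have := count1 (d := d) i a ha
  rw [hi] at this
  rw [← Finset.sum_filter, Finset.sum_const, nsmul_eq_mul, mul_one, this]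
  push_cast; ring

lemma sum_VS_sq {n : ℕ} {d : Fin n → ℕ} (b a : ℕ) (ha : a + a ≤ n - 1) :
    ∑ s : Fin (n-1) ↪ NR d, ((VS s b a).card : ℝ)^2
      = ((Finset.univ.filter (fun i => d i = b)).card : ℝ) *
        (((n-1).factorial : ℝ) * (((b - 1).choose a : ℝ)
        * ((Fintype.card (NR d) - (b - 1)).choose (n - 1 - a) : ℝ)))
        + ((Finset.univ.filter (fun i => d i = b)).card : ℝ) *
          (((Finset.univ.filter (fun i => d i = b)).card : ℝ) - 1) *
        (((n-1).factorial : ℝ) * (((b - 1).choose a : ℝ)^2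
        * ((Fintype.card (NR d) - ((b - 1) + (b - 1))).choose (n - 1 - (a + a)) : ℝ))) := by
  have h1 : ∀ s : Fin (n-1) ↪ NR d, ((VS s b a).card : ℝ)
      = ∑ i ∈ Finset.univ.filter (fun i => d i = b), if cs s i = a then (1:ℝ) else 0 := by
    intro s
    rw [← Finset.sum_filter, Finset.filter_filter]
    simp [VS]
  simp only [h1, sq, Finset.sum_mul_sum]
  rw [Finset.sum_comm]
  set B := Finset.univ.filter (fun i => d i = b) with hB
  set c1 : ℝ := (((n-1).factorial : ℝ) * (((b - 1).choose a : ℝ)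
        * ((Fintype.card (NR d) - (b - 1)).choose (n - 1 - a) : ℝ))) with hc1
  set c2 : ℝ := (((n-1).factorial : ℝ) * (((b - 1).choose a : ℝ) * ((b - 1).choose a : ℝ)
        * ((Fintype.card (NR d) - ((b - 1) + (b - 1))).choose (n - 1 - (a + a)) : ℝ))) with hc2
  have key : ∀ i ∈ B, ∀ j ∈ B, ∑ s : Fin (n-1) ↪ NR d,
      (if cs s i = a then (1:ℝ) else 0) * (if cs s j = a then (1:ℝ) else 0)
      = (if i = j then c1 - c2 else 0) + c2 := by
    intro i hi j hj
    simp only [hB, Finset.mem_filter, Finset.mem_univ, true_and] at hi hj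
    by_cases hij : i = j
    · subst hij
      rw [if_pos rfl, sub_add_cancel]
      have := count1 (d := d) i a (by omega)
      rw [hi] at this
      simp only [mul_ite, mul_one, mul_zero, ← ite_and, and_self]
      rw [← Finset.sum_filter, Finset.sum_const, nsmul_eq_mul, mul_one, this, hc1]
      push_cast; ring
    · rw [if_neg hij, zero_add]
      have := count2 (d := d) i j hij a ha
      rw [hi, hj] at this
      have e : ∀ s : Fin (n-1) ↪ NR d,
        (if cs s i = a then (1:ℝ) else 0) * (if cs s j = a then (1:ℝ) else 0)
          = if (cs s i = a ∧ cs s j = a) then (1:ℝ) else 0 := by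
        intro s; split_ifs <;> simp_all
      simp only [e]
      rw [← Finset.sum_filter, Finset.sum_const, nsmul_eq_mul, mul_one, this, hc2]
      push_cast; ring
  have h2 : ∀ i ∈ B, ∑ s : Fin (n-1) ↪ NR d, ∑ j ∈ B,
      (if cs s i = a then (1:ℝ) else 0) * (if cs s j = a then (1:ℝ) else 0)
      = (c1 - c2) + (B.card : ℝ) * c2 := by
    intro i hi
    rw [Finset.sum_comm, Finset.sum_congr rfl (key i hi), Finset.sum_add_distrib,
      Finset.sum_ite_eq, if_pos hi]
    simp
  rw [Finset.sum_congr rfl h2]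
  simp only [Finset.sum_const, nsmul_eq_mul]
  ring

lemma card_emb {n : ℕ} (d : Fin n → ℕ) :
    (Fintype.card (Fin (n-1) ↪ NR d) : ℝ)
      = ((n-1).factorial : ℝ) * ((Fintype.card (NR d)).choose (n-1) : ℝ) := by
  rw [Fintype.card_embedding_eq, Fintype.card_fin, Nat.descFactorial_eq_factorial_mul_choose]
  push_cast; rfl

end Hyper

section Analysis

lemma ratio_tendsto (m h : ℕ → ℕ) (ρ : ℝ) (hm : Tendsto m atTop atTop)
    (hmh : ∀ n, m n ≤ h n)
    (hρ : Tendsto (fun n => (m n : ℝ) / (h n : ℝ)) atTop (nhds ρ)) (A j : ℕ) :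
    Tendsto (fun n => ((h n - (A + j)).choose (m n - A) : ℝ) / ((h n).choose (m n) : ℝ))
      atTop (nhds (ρ ^ A * (1 - ρ) ^ j)) := by
  have hh : Tendsto h atTop atTop := tendsto_atTop_mono hmh hm
  have hhR : Tendsto (fun n => (h n : ℝ)) atTop atTop :=
    tendsto_natCast_atTop_atTop.comp hh
  have hc : ∀ c : ℝ, Tendsto (fun n => c / (h n : ℝ)) atTop (nhds 0) :=
    fun c => hhR.const_div_atTop c
  induction j with
  | zero =>
    simp only [add_zero, pow_zero, mul_one]
    induction A with
    | zero =>
      simp only [pow_zero, Nat.sub_zero]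
      refine tendsto_const_nhds.congr fun n => ?_
      rw [div_self]
      have := Nat.choose_pos (hmh n)
      positivity
    | succ A ih =>
      have h1 : Tendsto (fun n => ((m n : ℝ) / h n - (A : ℝ) / h n) / (1 - (A:ℝ) / h n)) atTop
          (nhds ((ρ - 0) / (1 - 0))) :=
        (hρ.sub (hc A)).div (tendsto_const_nhds.sub (hc A)) (by norm_num)
      have h2 := ih.mul h1
      rw [sub_zero, sub_zero, div_one, ← pow_succ] at h2
      refine h2.congr' ?_
      filter_upwards [hm.eventually_ge_atTop (A + 2)] with n hn
      have hn2 := hmh n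
      obtain ⟨M, hM⟩ : ∃ M, m n = M + 1 + A := ⟨m n - 1 - A, by omega⟩
      obtain ⟨N, hN⟩ : ∃ N, h n = N + 1 + A := ⟨h n - 1 - A, by omega⟩
      have e1 : h n - A = N + 1 := by omega
      have e2 : m n - A = M + 1 := by omega
      have e3 : h n - (A + 1) = N := by omega
      have e4 : m n - (A + 1) = M := by omega
      have hpos : (0:ℝ) < h n := by
        have : 0 < h n := by omega
        exact_mod_cast this
      have r1 : ((m n : ℝ) / h n - (A : ℝ) / h n) / (1 - (A:ℝ) / h n) = ((M:ℝ)+1)/((N:ℝ)+1) := by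
        have : (1 - (A:ℝ) / h n) = (h n - A) / h n := by field_simp
        rw [this, ← sub_div, div_div_div_cancel_right₀ hpos.ne', hM, hN]
        push_cast; ring
      rw [r1, e1, e2, e3, e4]
      have key : ((N:ℝ)+1) * (N.choose M : ℝ) = ((N+1).choose (M+1) : ℝ) * ((M:ℝ)+1) := by
        exact_mod_cast Nat.add_one_mul_choose_eq N M
      have hN0 : ((N:ℝ)+1) ≠ 0 := by positivity
      rw [div_mul_div_comm, ← key, mul_comm ((h n).choose (m n) : ℝ),
        mul_div_mul_left _ _ hN0]
  | succ j ih =>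
    have h1 : Tendsto (fun n => (1 - ((A+j : ℕ):ℝ) / h n - ((m n : ℝ) / h n - (A : ℝ) / h n))
        / (1 - ((A+j : ℕ):ℝ) / h n)) atTop
          (nhds ((1 - 0 - (ρ - 0)) / (1 - 0))) :=
      ((tendsto_const_nhds.sub (hc _)).sub (hρ.sub (hc A))).div
        (tendsto_const_nhds.sub (hc _)) (by norm_num)
    have h2 := ih.mul h1
    rw [sub_zero, sub_zero, div_one, mul_assoc, ← pow_succ] at h2
    refine h2.congr' ?_
    filter_upwards [hm.eventually_ge_atTop (A + j + 2)] with n hn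
    have hn2 := hmh n
    obtain ⟨M, hM⟩ : ∃ M, m n = M + A := ⟨m n - A, by omega⟩
    obtain ⟨N, hN⟩ : ∃ N, h n = N + 1 + (A + j) := ⟨h n - 1 - (A + j), by omega⟩
    have e1 : h n - (A + j) = N + 1 := by omega
    have e2 : m n - A = M := by omega
    have e3 : h n - (A + (j + 1)) = N := by omega
    have hpos : (0:ℝ) < h n := by
      have : 0 < h n := by omega
      exact_mod_cast this
    have r1 : (1 - ((A+j : ℕ):ℝ) / h n - ((m n : ℝ) / h n - (A : ℝ) / h n))
        / (1 - ((A+j : ℕ):ℝ) / h n) = ((N:ℝ)+1-M)/((N:ℝ)+1) := by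
      have : (1 - ((A+j : ℕ):ℝ) / h n) = (h n - (A+j : ℕ)) / h n := by field_simp
      rw [this, ← sub_div, ← sub_div, div_div_div_cancel_right₀ hpos.ne', hM, hN]
      push_cast; ring
    rw [r1, e1, e2, e3]
    have key : (N.choose M : ℝ) * ((N:ℝ)+1) = ((N+1).choose M : ℝ) * ((N:ℝ)+1-M) := by
      have h0 := Nat.choose_mul_succ_eq N M
      rcases le_or_gt M (N+1) with hle | hlt
      · have : ((N + 1 - M : ℕ) : ℝ) = (N:ℝ)+1-M := by
          rw [Nat.cast_sub hle]; push_cast; ring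
        rw [← this]
        exact_mod_cast h0
      · rw [Nat.choose_eq_zero_of_lt hlt, Nat.choose_eq_zero_of_lt (by omega)]; simp
    have hN0 : ((N:ℝ)+1) ≠ 0 := by positivity
    rw [div_mul_div_comm, ← key, mul_div_mul_right _ _ hN0]

lemma mu1_tendsto
    (dseq : (n : ℕ) → Fin n → ℕ) (p : ℕ → ℝ) (hpnn : ∀ k, 0 ≤ p k)
    (μ2 : ℝ) (hμ2 : HasSum (fun k : ℕ => (k : ℝ) ^ 2 * p k) μ2)
    (hpconv : ∀ k : ℕ, Tendsto
      (fun n => (Nat.card {i : Fin n // dseq n i = k} : ℝ) / n) atTop (nhds (p k)))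
    (hμ2conv : Tendsto (fun n => (∑ i, (dseq n i : ℝ) ^ 2) / n) atTop (nhds μ2)) :
    Tendsto (fun n => (∑ i, (dseq n i : ℝ)) / n) atTop (nhds (mu1 p)) := by
  have hsum : Summable (fun k : ℕ => (k:ℝ) * p k) := by
    refine Summable.of_nonneg_of_le (fun k => mul_nonneg (Nat.cast_nonneg _) (hpnn k))
      (fun k => ?_) hμ2.summable
    refine mul_le_mul_of_nonneg_right ?_ (hpnn k)
    have : k ≤ k^2 := Nat.le_self_pow (by norm_num) k
    exact_mod_cast this
  have hg : Tendsto (fun K => ∑ k ∈ Finset.range K, (k:ℝ) * p k) atTop (nhds (mu1 p)) :=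
    hsum.hasSum.tendsto_sum_nat
  have hμ2nn : 0 ≤ μ2 := hμ2.nonneg fun k => mul_nonneg (sq_nonneg _) (hpnn k)
  have hfK : ∀ K : ℕ, Tendsto (fun n => ∑ k ∈ Finset.range K, (k:ℝ) *
      ((Nat.card {i : Fin n // dseq n i = k} : ℝ) / n)) atTop
      (nhds (∑ k ∈ Finset.range K, (k:ℝ) * p k)) :=
    fun K => tendsto_finsetSum _ fun k _ => (hpconv k).const_mul _
  have hf' : ∀ K n : ℕ, ∑ k ∈ Finset.range K, (k:ℝ) *
      ((Nat.card {i : Fin n // dseq n i = k} : ℝ) / n)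
      = (∑ i, if dseq n i < K then (dseq n i : ℝ) else 0) / n := by
    intro K n
    rw [Finset.sum_div]
    have : ∀ i, (if dseq n i < K then (dseq n i : ℝ) else 0) / (n:ℝ)
        = ∑ k ∈ Finset.range K, if dseq n i = k then (k:ℝ) / n else 0 := by
      intro i
      rw [Finset.sum_ite_eq]
      simp only [Finset.mem_range]
      split_ifs <;> simp
    simp only [this]
    rw [Finset.sum_comm]
    refine Finset.sum_congr rfl fun k _ => ?_
    rw [← Finset.sum_filter, Finset.sum_const, nsmul_eq_mul, Nat.card_eq_fintype_card,
      Fintype.card_subtype]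
    ring
  have hdiff : ∀ K n : ℕ, 0 < K → |(∑ i, (dseq n i : ℝ)) / n -
      (∑ i, if dseq n i < K then (dseq n i : ℝ) else 0) / n|
      ≤ ((∑ i, (dseq n i : ℝ)^2) / n) / K := by
    intro K n hK
    have hK' : (0:ℝ) < K := by exact_mod_cast hK
    rw [← sub_div, ← Finset.sum_sub_distrib, div_right_comm, abs_div, Nat.abs_cast]
    refine div_le_div_of_nonneg_right ?_ (Nat.cast_nonneg n)
    rw [Finset.sum_div]
    refine (Finset.abs_sum_le_sum_abs _ _).trans (Finset.sum_le_sum fun i _ => ?_)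
    split_ifs with hi
    · simp; positivity
    · rw [sub_zero, Nat.abs_cast, le_div_iff₀ hK', sq]
      push Not at hi
      have : (K:ℝ) ≤ dseq n i := by exact_mod_cast hi
      exact mul_le_mul_of_nonneg_left this (Nat.cast_nonneg _)
  rw [Metric.tendsto_atTop]
  intro ε hε
  obtain ⟨K, hK0, hK1, hK2⟩ : ∃ K : ℕ, 0 < K ∧
      |∑ k ∈ Finset.range K, (k:ℝ) * p k - mu1 p| < ε/3 ∧ (μ2+1) / K < ε/3 := by
    have e1 := (Metric.tendsto_nhds.1 hg) (ε/3) (by positivity)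
    have e2 : Tendsto (fun K : ℕ => (μ2+1) / (K:ℝ)) atTop (nhds 0) :=
      tendsto_const_div_atTop_nhds_zero_nat _
    have e3 := e2.eventually_lt_const (show (0:ℝ) < ε/3 by positivity)
    obtain ⟨K, h1, h2, h3⟩ := ((eventually_gt_atTop 0).and (e1.and e3)).exists
    exact ⟨K, h1, by simpa [Real.dist_eq] using h2, h3⟩
  have e1 := (Metric.tendsto_nhds.1 (hfK K)) (ε/3) (by positivity)
  have e2 := hμ2conv.eventually_lt_const (show μ2 < μ2 + 1 by linarith)
  obtain ⟨N, hN⟩ := eventually_atTop.1 (e1.and e2)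
  refine ⟨N, fun n hn => ?_⟩
  obtain ⟨h1, h2⟩ := hN n hn
  rw [hf', Real.dist_eq] at h1
  have h3 := hdiff K n hK0
  have hK' : (0:ℝ) < K := by exact_mod_cast hK0
  have h4 : ((∑ i, (dseq n i : ℝ)^2) / n) / K ≤ (μ2+1)/K :=
    div_le_div_of_nonneg_right h2.le hK'.le
  rw [Real.dist_eq]
  rw [abs_lt] at *
  rw [abs_le] at h3
  constructor <;> linarith [h3.1, h3.2, h1.1, h1.2, hK1.1, hK1.2]

lemma card_NR_real {n : ℕ} (d : Fin n → ℕ) (hd : ∀ i, 1 ≤ d i) :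
    (Fintype.card (NR d) : ℝ) = (∑ i, (d i : ℝ)) - n := by
  rw [card_NR]
  push_cast [Nat.cast_sub (hd _)]
  simp

lemma card_NR_ge {n : ℕ} (d : Fin n → ℕ) (hd : ∀ i, 1 ≤ d i) (hge : 2 * n ≤ ∑ i, d i) :
    n ≤ Fintype.card (NR d) := by
  have h1 := card_NR_real d hd
  have h2 : (2:ℝ) * n ≤ ∑ i, (d i : ℝ) := by exact_mod_cast hge
  have : (n:ℝ) ≤ Fintype.card (NR d) := by linarith
  exact_mod_cast this

lemma var_tendsto
    (dseq : (n : ℕ) → Fin n → ℕ)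
    (hd : ∀ n i, 1 ≤ dseq n i)
    (hge : ∀ n, 2 * n ≤ ∑ i, dseq n i)
    (p : ℕ → ℝ) (hpnn : ∀ k, 0 ≤ p k)
    (μ2 : ℝ) (hμ2 : HasSum (fun k : ℕ => (k : ℝ) ^ 2 * p k) μ2)
    (hpconv : ∀ k : ℕ, Tendsto
      (fun n => (Nat.card {i : Fin n // dseq n i = k} : ℝ) / n) atTop (nhds (p k)))
    (hμ2conv : Tendsto (fun n => (∑ i, (dseq n i : ℝ) ^ 2) / n) atTop (nhds μ2))
    (a b : ℕ) (hab : a < b) :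
    Tendsto (fun n => (∑ s : Fin (n-1) ↪ NR (dseq n),
        (((VS s b a).card : ℝ) / n - p b * binomP (rho p) (b-1) a)^2)
        / (Fintype.card (Fin (n-1) ↪ NR (dseq n)) : ℝ)) atTop (nhds 0) := by
  have hmu := mu1_tendsto dseq p hpnn μ2 hμ2 hpconv hμ2conv
  have hmu2 : 2 ≤ mu1 p := by
    refine ge_of_tendsto hmu ?_
    filter_upwards [eventually_gt_atTop 0] with n hn
    have hn' : (0:ℝ) < n := by exact_mod_cast hn
    rw [le_div_iff₀ hn']
    exact_mod_cast hge n
  have hinv : Tendsto (fun n : ℕ => (1:ℝ) / n) atTop (nhds 0) :=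
    tendsto_const_div_atTop_nhds_zero_nat 1
  set ρ := rho p with hρdef
  have hρ : Tendsto (fun n => ((n - 1 : ℕ) : ℝ) / (Fintype.card (NR (dseq n)) : ℝ)) atTop
      (nhds ρ) := by
    have h1 : Tendsto (fun n : ℕ => (1 - (1:ℝ)/n) / ((∑ i, (dseq n i : ℝ)) / n - 1)) atTop
        (nhds ((1 - 0) / (mu1 p - 1))) :=
      (tendsto_const_nhds.sub hinv).div (hmu.sub tendsto_const_nhds) (by linarith)
    rw [sub_zero] at h1
    refine h1.congr' ?_
    filter_upwards [eventually_gt_atTop 0] with n hn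
    have hn' : (0:ℝ) < n := by exact_mod_cast hn
    rw [card_NR_real _ (hd n), Nat.cast_sub hn]
    have e1 : (1 - (1:ℝ)/n) = (n - 1) / n := by field_simp
    have e2 : ((∑ i, (dseq n i : ℝ)) / n - 1) = ((∑ i, (dseq n i : ℝ)) - n) / n := by field_simp
    rw [e1, e2, div_div_div_cancel_right₀ hn'.ne']
    simp
  have hm : Tendsto (fun n : ℕ => n - 1) atTop atTop := tendsto_sub_atTop_nat 1
  have hmh : ∀ n, n - 1 ≤ Fintype.card (NR (dseq n)) := fun n => by
    have := card_NR_ge (dseq n) (hd n) (hge n)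
    omega
  have R1 := ratio_tendsto (fun n => n - 1) (fun n => Fintype.card (NR (dseq n))) ρ hm hmh hρ
    a (b - 1 - a)
  have R2 := ratio_tendsto (fun n => n - 1) (fun n => Fintype.card (NR (dseq n))) ρ hm hmh hρ
    (a + a) ((b - 1 - a) + (b - 1 - a))
  have i1 : a + (b - 1 - a) = b - 1 := by omega
  have i2 : (a + a) + ((b - 1 - a) + (b - 1 - a)) = (b - 1) + (b - 1) := by omega
  rw [i1] at R1
  rw [i2] at R2
  have P1 := R1.const_mul (((b-1).choose a : ℝ))
  have P2 := R2.const_mul (((b-1).choose a : ℝ)^2)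
  set B := binomP ρ (b-1) a with hB
  have e1 : ((b-1).choose a : ℝ) * (ρ ^ a * (1 - ρ) ^ (b - 1 - a)) = B := by
    rw [hB, binomP]; ring
  have e2 : ((b-1).choose a : ℝ)^2 * (ρ ^ (a + a) * (1 - ρ) ^ ((b - 1 - a) + (b - 1 - a)))
      = B^2 := by
    rw [hB, binomP]; ring
  rw [e1] at P1
  rw [e2] at P2
  have hx := hpconv b
  have lim := (((hinv.mul (hx.mul P1)).add ((hx.mul (hx.sub hinv)).mul P2)).sub
    ((hx.mul P1).const_mul (2 * (p b * B)))).add_const ((p b * B)^2)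
  have e3 : 0 * (p b * B) + p b * (p b - 0) * B ^ 2 - 2 * (p b * B) * (p b * B) + (p b * B) ^ 2
      = 0 := by ring
  rw [e3] at lim
  refine lim.congr' ?_
  filter_upwards [eventually_ge_atTop (a + a + 2)] with n hn
  have hn' : (0:ℝ) < n := by
    have : 0 < n := by omega
    exact_mod_cast this
  have hch : (0:ℝ) < ((Fintype.card (NR (dseq n))).choose (n-1) : ℝ) := by
    exact_mod_cast Nat.choose_pos (hmh n)
  have hfa : (0:ℝ) < ((n-1).factorial : ℝ) := by exact_mod_cast Nat.factorial_pos _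
  have hexp : ∑ s : Fin (n-1) ↪ NR (dseq n), (((VS s b a).card : ℝ) / n - p b * B)^2
      = (1/(n:ℝ)^2) * (∑ s : Fin (n-1) ↪ NR (dseq n), ((VS s b a).card : ℝ)^2)
        - (2 * (p b * B) / n) * (∑ s : Fin (n-1) ↪ NR (dseq n), ((VS s b a).card : ℝ))
        + (p b * B)^2 * (Fintype.card (Fin (n-1) ↪ NR (dseq n)) : ℝ) := by
    have : (p b * B)^2 * (Fintype.card (Fin (n-1) ↪ NR (dseq n)) : ℝ)
        = ∑ s : Fin (n-1) ↪ NR (dseq n), (p b * B)^2 := by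
      rw [Finset.sum_const, nsmul_eq_mul, Finset.card_univ]; ring
    rw [this, Finset.mul_sum, Finset.mul_sum, ← Finset.sum_sub_distrib, ← Finset.sum_add_distrib]
    refine Finset.sum_congr rfl fun s _ => by ring
  rw [hexp, sum_VS _ _ (by omega), sum_VS_sq _ _ (by omega), card_emb]
  have hcard : (Nat.card {i : Fin n // dseq n i = b} : ℝ)
      = ((Finset.univ.filter (fun i => dseq n i = b)).card : ℝ) := by
    rw [Nat.card_eq_fintype_card, Fintype.card_subtype]
  rw [hcard]
  generalize ((Finset.univ.filter (fun i => dseq n i = b)).card : ℝ) = nb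
  generalize ((Fintype.card (NR (dseq n)) - (b - 1)).choose (n - 1 - a) : ℝ) = c1
  generalize ((Fintype.card (NR (dseq n)) - ((b - 1) + (b - 1))).choose (n - 1 - (a + a)) : ℝ)
    = c2
  generalize ((Fintype.card (NR (dseq n))).choose (n-1) : ℝ) = c0 at hch
  generalize ((n-1).factorial : ℝ) = f at hfa
  field_simp

end Analysis

section Final

lemma prob_bound {n : ℕ} (hn : 3 ≤ n) {d : Fin n → ℕ} (hd : ∀ i, 1 ≤ d i)
    (hge : 2 * n ≤ ∑ i, d i) (a₁ b₁ a₂ b₂ : ℕ) (L₁ L₂ L : ℝ) (hL : L = a₂ * (L₂ * L₁))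
    (ε : ℝ) (hε : 0 < ε) :
    (Nat.card {E : Path d // IsExecPath d E ∧
          ε < |(Rcount E b₁ b₂ a₁ a₂ : ℝ) / n - L|} : ℝ)
        / (Nat.card {E : Path d // IsExecPath d E} : ℝ)
      ≤ 1 / ε^2 * (16 / (n:ℝ) + 4 * (a₂:ℝ)^2 * ((∑ s : Fin (n-1) ↪ NR d,
        (((VS s b₂ a₂).card : ℝ) / n - L₂)^2) / (Fintype.card (Fin (n-1) ↪ NR d) : ℝ))
        + 4 * (a₂:ℝ)^2 * L₂^2 * ((∑ s : Fin (n-1) ↪ NR d,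
        (((VS s b₁ a₁).card : ℝ) / n - L₁)^2) / (Fintype.card (Fin (n-1) ↪ NR d) : ℝ))) := by
  have hn' : (0:ℝ) < n := by
    have : 0 < n := by omega
    exact_mod_cast this
  have hNR := card_NR_ge d hd hge
  have hfa : (0:ℝ) < ((n-1).factorial : ℝ) := by exact_mod_cast Nat.factorial_pos _
  have hEpos : (0:ℝ) < (Fintype.card (Fin (n-1) ↪ NR d) : ℝ) := by
    rw [card_emb]
    have : 0 < (Fintype.card (NR d)).choose (n-1) := Nat.choose_pos (by omega)
    positivity
  have htot : (Nat.card {E : Path d // IsExecPath d E} : ℝ)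
      = (Fintype.card (Fin (n-1) ↪ NR d) : ℝ) * ((n-1).factorial : ℝ) := by
    have h := exec_sum hd (fun _ => (1:ℝ))
    simp only [Finset.sum_const, nsmul_eq_mul, mul_one] at h
    simp only [card_G' (show 1 ≤ n by omega), Finset.sum_const, nsmul_eq_mul,
      Finset.card_univ] at h
    rw [Nat.card_eq_fintype_card, Fintype.card_subtype, h]
  have hbad : (Nat.card {E : Path d // IsExecPath d E ∧
          ε < |(Rcount E b₁ b₂ a₁ a₂ : ℝ) / n - L|} : ℝ)
      ≤ 1/ε^2 * ∑ E ∈ Finset.univ.filter (fun E => IsExecPath d E),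
          ((Rcount E b₁ b₂ a₁ a₂ : ℝ) / n - L)^2 := by
    rw [Nat.card_eq_fintype_card, Fintype.card_subtype, ← Finset.filter_filter,
      Finset.card_filter, Finset.mul_sum]
    push_cast
    refine Finset.sum_le_sum fun E _ => ?_
    split_ifs with h
    · rw [one_div, ← div_eq_inv_mul, le_div_iff₀ (by positivity), one_mul,
        ← sq_abs (_ - L)]
      exact pow_le_pow_left₀ hε.le h.le 2
    · positivity
  have hsum : ∑ E ∈ Finset.univ.filter (fun E => IsExecPath d E),
          ((Rcount E b₁ b₂ a₁ a₂ : ℝ) / n - L)^2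
      ≤ ∑ s : Fin (n-1) ↪ NR d, ((n-1).factorial : ℝ) * (16 / (n:ℝ)
          + 4 * (a₂:ℝ)^2 * (((VS s b₂ a₂).card : ℝ) / n - L₂)^2
          + 4 * (a₂:ℝ)^2 * L₂^2 * (((VS s b₁ a₁).card : ℝ) / n - L₁)^2) := by
    rw [exec_sum hd]
    refine Finset.sum_le_sum fun s _ => ?_
    set I := Finset.univ.filter (fun k => pv s k ∈ VS s b₂ a₂) with hI
    set A := VS s b₁ a₁ with hA
    have hIc : (I.card : ℝ) = a₂ * ((VS s b₂ a₂).card : ℝ) := by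
      exact_mod_cast card_I s b₂ a₂
    have hcv := condVar' hn (pv s) I A
    set x : ℝ := ((VS s b₂ a₂).card : ℝ) / n with hx
    set y : ℝ := (A.card : ℝ) / n with hy
    have hy0 : 0 ≤ y := by positivity
    have hy1 : y ≤ 1 := by
      rw [hy, div_le_one hn']
      have : A.card ≤ n := by simpa using Finset.card_le_univ A
      exact_mod_cast this
    have hmean : (I.card : ℝ) * (A.card : ℝ) / (n : ℝ) = n * (a₂ * x * y) := by
      rw [hIc, hx, hy]; field_simp
    rw [hmean] at hcv
    have hdet : 2 * (a₂ * x * y - L)^2 ≤ 4 * (a₂:ℝ)^2 * (x - L₂)^2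
        + 4 * (a₂:ℝ)^2 * L₂^2 * (y - L₁)^2 := by
      have e : a₂ * x * y - L = a₂ * ((x - L₂) * y) + a₂ * (L₂ * (y - L₁)) := by
        rw [hL]; ring
      have h1 : (a₂ * ((x - L₂) * y))^2 ≤ (a₂:ℝ)^2 * (x - L₂)^2 := by
        have : y^2 ≤ 1 := pow_le_one₀ hy0 hy1
        have h3 := mul_le_mul_of_nonneg_left this
          (by positivity : 0 ≤ (a₂:ℝ)^2 * (x - L₂)^2)
        nlinarith [h3]
      rw [e]
      nlinarith [sq_nonneg (a₂ * ((x - L₂) * y) - a₂ * (L₂ * (y - L₁))), h1]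
    calc ∑ r ∈ Finset.univ.filter (fun r : Fin (n-1) → Fin n => Acy id (pv s) r),
          ((Rcount (mkPath hd s r) b₁ b₂ a₁ a₂ : ℝ) / n - L)^2
        ≤ ∑ r ∈ Finset.univ.filter (fun r : Fin (n-1) → Fin n => Acy id (pv s) r),
          (2 / (n:ℝ)^2 * (((I.filter (fun i => r i ∈ A)).card : ℝ) - n * (a₂ * x * y))^2
            + 2 * (a₂ * x * y - L)^2) := by
          refine Finset.sum_le_sum fun r hr => ?_
          rw [Rcount_mkPath hd s r (Finset.mem_filter.1 hr).2]
          set X : ℝ := ((I.filter (fun i => r i ∈ A)).card : ℝ) with hX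
          have e : 2 / (n:ℝ)^2 * (X - n * (a₂ * x * y))^2 = 2 * (X / n - a₂ * x * y)^2 := by
            field_simp
          rw [e]
          nlinarith [sq_nonneg ((X / n - a₂ * x * y) - (a₂ * x * y - L))]
      _ = 2 / (n:ℝ)^2 * (∑ r ∈ Finset.univ.filter
            (fun r : Fin (n-1) → Fin n => Acy id (pv s) r),
            (((I.filter (fun i => r i ∈ A)).card : ℝ) - n * (a₂ * x * y))^2)
          + ((n-1).factorial : ℝ) * (2 * (a₂ * x * y - L)^2) := by
          rw [Finset.sum_add_distrib, Finset.mul_sum, Finset.sum_const, nsmul_eq_mul,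
            card_G' (show 1 ≤ n by omega)]
      _ ≤ 2 / (n:ℝ)^2 * (8 * (n : ℝ) * ((n-1).factorial : ℝ))
          + ((n-1).factorial : ℝ) * (4 * (a₂:ℝ)^2 * (x - L₂)^2
            + 4 * (a₂:ℝ)^2 * L₂^2 * (y - L₁)^2) := by
          refine add_le_add (mul_le_mul_of_nonneg_left hcv (by positivity))
            (mul_le_mul_of_nonneg_left hdet hfa.le)
      _ = _ := by field_simp; ring
  rw [htot, div_le_iff₀ (by positivity)]
  refine hbad.trans ((mul_le_mul_of_nonneg_left hsum (by positivity)).trans (le_of_eq ?_))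
  rw [← Finset.mul_sum, Finset.sum_add_distrib, Finset.sum_add_distrib, ← Finset.mul_sum,
    ← Finset.mul_sum, Finset.sum_const, nsmul_eq_mul, Finset.card_univ]
  field_simp

end Final

/-- Under the standing assumptions, for `0 ≤ a₁ < b₁` and `0 ≤ a₂ < b₂`,
`R_{b₁,b₂,a₁,a₂}(T(dⁿ), dⁿ)/n → a₂ p(b₂) P(Bin(b₂−1,ρ)=a₂) ⋅ p(b₁) P(Bin(b₁−1,ρ)=a₁)`
in probability, where the law at stage `n` is uniform on execution paths of the
coalescent for `dⁿ`. -/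
theorem R_convergence
    (dseq : (n : ℕ) → Fin n → ℕ)
    (hd : ∀ n i, 1 ≤ dseq n i)
    (heven : ∀ n, Even (∑ i, dseq n i))
    (hge : ∀ n, 2 * n ≤ ∑ i, dseq n i)
    (p : ℕ → ℝ) (hp0 : p 0 = 0) (hpnn : ∀ k, 0 ≤ p k) (hp1 : HasSum p 1)
    (hp2 : p 2 < 1)
    (μ2 : ℝ) (hμ2 : HasSum (fun k : ℕ => (k : ℝ) ^ 2 * p k) μ2) (hμ2pos : 0 < μ2)
    (hpconv : ∀ k : ℕ, Tendsto
      (fun n => (Nat.card {i : Fin n // dseq n i = k} : ℝ) / n) atTop (nhds (p k)))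
    (hμ2conv : Tendsto (fun n => (∑ i, (dseq n i : ℝ) ^ 2) / n) atTop (nhds μ2))
    (a₁ b₁ a₂ b₂ : ℕ) (h1 : a₁ < b₁) (h2 : a₂ < b₂) :
    ∀ ε : ℝ, 0 < ε → Tendsto (fun n =>
      (Nat.card {E : Path (dseq n) // IsExecPath (dseq n) E ∧
          ε < |(Rcount E b₁ b₂ a₁ a₂ : ℝ) / n
                - (a₂ : ℝ) * p b₂ * binomP (rho p) (b₂ - 1) a₂
                  * (p b₁ * binomP (rho p) (b₁ - 1) a₁)|} : ℝ)
        / (Nat.card {E : Path (dseq n) // IsExecPath (dseq n) E} : ℝ))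
      atTop (nhds 0) := by
  intro ε hε
  set L₂ : ℝ := p b₂ * binomP (rho p) (b₂ - 1) a₂ with hL₂
  set L₁ : ℝ := p b₁ * binomP (rho p) (b₁ - 1) a₁ with hL₁
  have hV2 := var_tendsto dseq hd hge p hpnn μ2 hμ2 hpconv hμ2conv a₂ b₂ h2
  have hV1 := var_tendsto dseq hd hge p hpnn μ2 hμ2 hpconv hμ2conv a₁ b₁ h1
  have hinv : Tendsto (fun n : ℕ => (16:ℝ) / n) atTop (nhds 0) :=
    tendsto_const_div_atTop_nhds_zero_nat 16
  have lim := ((hinv.add (hV2.const_mul (4 * (a₂:ℝ)^2))).add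
    (hV1.const_mul (4 * (a₂:ℝ)^2 * L₂^2))).const_mul (1/ε^2)
  simp only [mul_zero, add_zero] at lim
  refine tendsto_of_tendsto_of_tendsto_of_le_of_le' tendsto_const_nhds lim
    (Eventually.of_forall fun n => by positivity) ?_
  filter_upwards [eventually_ge_atTop 3] with n hn
  exact prob_bound hn (hd n) (hge n) a₁ b₁ a₂ b₂ L₁ L₂ _ (by rw [hL₂]; ring) ε hε

end TWG
end

section
/- Under the Poisson approximation standing assumptions, suppose additionally that p(0) + p(1) < 1. Define |𝓛_n| = ∑_{v∈[n]} d^n(v)(d^n(v)−1)/2 and |𝓜_n| = ∑_{u<v, uv∉e(h_n)} (d^n(u)(d^n(u)−1)/2)·d^n(v)(d^n(v)−1). Then |𝓛_n| = Θ(n) and |𝓜_n| = Θ(n²) as n → ∞; that is, there exist constants 0 < c ≤ C < ∞ such that cn ≤ |𝓛_n| ≤ Cn and cn² ≤ |𝓜_n| ≤ Cn² for all sufficiently large n. -/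
open Classical Filter

namespace TWG

lemma pair_count (n : ℕ) (G : SimpleGraph (Fin n)) (g : Fin n → ℝ)
    (hg : ∀ i, g i = 0 ∨ g i = 1) (e : ℝ)
    (hdeg : ∀ v : Fin n, (Nat.card {w : Fin n // G.Adj v w} : ℝ) ≤ e) :
    (∑ i, g i) ^ 2 ≤ 2 * (∑ x : Fin n × Fin n,
      if x.1 < x.2 ∧ ¬ G.Adj x.1 x.2 then g x.1 * g x.2 else 0) + n + n * e := by
  set F : Fin n × Fin n → ℝ := fun x =>
    if x.1 < x.2 ∧ ¬ G.Adj x.1 x.2 then g x.1 * g x.2 else 0 with hF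
  have hswap : ∑ x : Fin n × Fin n, F x.swap = ∑ x, F x := (Equiv.prodComm (Fin n) (Fin n)).sum_comp F
  have hsq : (∑ i, g i) ^ 2 = ∑ x : Fin n × Fin n, g x.1 * g x.2 := by
    rw [sq, Finset.sum_mul_sum, Fintype.sum_prod_type]
  have hdiag : ∑ x : Fin n × Fin n, (if x.1 = x.2 then (1 : ℝ) else 0) = n := by
    rw [Fintype.sum_prod_type]; simp
  have hadj : ∑ x : Fin n × Fin n, (if G.Adj x.1 x.2 then (1 : ℝ) else 0) ≤ n * e := by
    rw [Fintype.sum_prod_type]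
    calc _ ≤ ∑ _v : Fin n, e := by
          refine Finset.sum_le_sum fun v _ => le_trans (le_of_eq ?_) (hdeg v)
          rw [Finset.sum_boole, Nat.card_eq_fintype_card, Fintype.card_subtype]
      _ = n * e := by simp
  have hpt : ∀ x : Fin n × Fin n, g x.1 * g x.2 ≤ F x + F x.swap
      + (if x.1 = x.2 then (1 : ℝ) else 0) + (if G.Adj x.1 x.2 then (1 : ℝ) else 0) := by
    rintro ⟨u, v⟩
    have h0 : 0 ≤ g u * g v := by
      rcases hg u with h | h <;> rcases hg v with h' | h' <;> simp [h, h']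
    have h1 : g u * g v ≤ 1 := by
      rcases hg u with h | h <;> rcases hg v with h' | h' <;> simp [h, h']
    simp only [hF, Prod.swap, G.adj_comm v u, mul_comm (g v) (g u)]
    rcases lt_trichotomy u v with h | h | h
    · by_cases ha : G.Adj u v <;> simp [ha, h, h.not_gt, h.ne, h1]
    · subst h; simp [h1]
    · by_cases ha : G.Adj u v <;> simp [ha, h, h.not_gt, h.ne', h1]
  have := Finset.sum_le_sum (s := Finset.univ) fun x _ => hpt x
  simp only [Finset.sum_add_distrib] at this
  rw [hswap, hdiag] at this
  rw [hsq]
  linarith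

lemma nat_mul_sub_nonneg (m : ℕ) : 0 ≤ (m : ℝ) * ((m : ℝ) - 1) := by
  rcases Nat.eq_zero_or_pos m with h | h
  · simp [h]
  · have : (1 : ℝ) ≤ m := by exact_mod_cast h
    exact mul_nonneg (by linarith) (by linarith)

/-- Under the Poisson-approximation standing assumptions, if moreover
`p(0) + p(1) < 1`, then with
`|𝓛ₙ| = ∑_v dⁿ(v)(dⁿ(v)−1)/2` and
`|𝓜ₙ| = ∑_{u<v, uv∉e(hₙ)} (dⁿ(u)(dⁿ(u)−1)/2) ⋅ dⁿ(v)(dⁿ(v)−1)`,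
one has `|𝓛ₙ| = Θ(n)` and `|𝓜ₙ| = Θ(n²)`. -/
theorem LM_theta_bounds
    (hseq : (n : ℕ) → SimpleGraph (Fin n))
    (hmaxdeg : ∀ ε : ℝ, 0 < ε → ∀ᶠ n in atTop, ∀ v : Fin n,
      (Nat.card {w : Fin n // (hseq n).Adj v w} : ℝ) ≤ ε * n)
    (dseq : (n : ℕ) → Fin n → ℕ)
    (heven : ∀ n, Even (∑ i, dseq n i))
    (p : ℕ → ℝ) (hpnn : ∀ k, 0 ≤ p k) (hp1 : HasSum p 1) (hp0 : p 0 < 1)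
    (μ2 : ℝ) (hμ2 : HasSum (fun k : ℕ => (k : ℝ) ^ 2 * p k) μ2)
    (hpconv : ∀ k : ℕ, Tendsto
      (fun n => (Nat.card {i : Fin n // dseq n i = k} : ℝ) / n) atTop (nhds (p k)))
    (hμ2conv : Tendsto (fun n => (∑ i, (dseq n i : ℝ) ^ 2) / n) atTop (nhds μ2))
    (α : ℕ → ℕ → ℝ) (hαnn : ∀ a b, 0 ≤ α a b)
    (hαconv : ∀ a b : ℕ, Tendsto (fun n =>
      (Nat.card {x : Fin n × Fin n //
          (hseq n).Adj x.1 x.2 ∧ dseq n x.1 = a ∧ dseq n x.2 = b} : ℝ) / (2 * n))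
      atTop (nhds (α a b)))
    (A : ℝ) (hA : HasSum (fun kl : ℕ × ℕ => (kl.1 : ℝ) * kl.2 * α kl.1 kl.2) A)
    (hηconv : Tendsto (fun n =>
      (∑ x : Fin n × Fin n, if (hseq n).Adj x.1 x.2 then
          (dseq n x.1 : ℝ) * (dseq n x.2) else 0) / (2 * n))
      atTop (nhds A))
    (hp01 : p 0 + p 1 < 1) :
    ∃ c C : ℝ, 0 < c ∧ ∃ N : ℕ, ∀ n, N ≤ n →
      (c * n ≤ ∑ v, (dseq n v : ℝ) * ((dseq n v : ℝ) - 1) / 2)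
      ∧ (∑ v, (dseq n v : ℝ) * ((dseq n v : ℝ) - 1) / 2 ≤ C * n)
      ∧ (c * (n : ℝ) ^ 2 ≤ ∑ x : Fin n × Fin n,
          if x.1 < x.2 ∧ ¬ (hseq n).Adj x.1 x.2 then
            (dseq n x.1 : ℝ) * ((dseq n x.1 : ℝ) - 1) / 2
              * ((dseq n x.2 : ℝ) * ((dseq n x.2 : ℝ) - 1)) else 0)
      ∧ ((∑ x : Fin n × Fin n,
          if x.1 < x.2 ∧ ¬ (hseq n).Adj x.1 x.2 then
            (dseq n x.1 : ℝ) * ((dseq n x.1 : ℝ) - 1) / 2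
              * ((dseq n x.2 : ℝ) * ((dseq n x.2 : ℝ) - 1)) else 0)
            ≤ C * (n : ℝ) ^ 2) := by
  obtain ⟨k, hk2, hk⟩ : ∃ k, 2 ≤ k ∧ 0 < p k := by
    by_contra! hcon
    have h : HasSum p (∑ b ∈ Finset.range 2, p b) := by
      refine hasSum_sum_of_ne_finset_zero fun b hb => ?_
      exact le_antisymm (hcon b (by simpa [Nat.succ_le_iff] using hb)) (hpnn b)
    have := h.unique hp1
    simp [Finset.sum_range_succ] at this
    linarith
  set q := p k with hq
  have hμ : 0 ≤ μ2 := hμ2.nonneg fun k => mul_nonneg (sq_nonneg _) (hpnn k)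
  have e1 := (hpconv k).eventually_const_lt (show q / 2 < p k by linarith)
  have e2 := hμ2conv.eventually_lt_const (show μ2 < μ2 + 1 by linarith)
  have e3 := hmaxdeg (q ^ 2 / 16) (by positivity)
  have e4 : ∀ᶠ n : ℕ in atTop, 16 / q ^ 2 ≤ (n : ℝ) :=
    tendsto_natCast_atTop_atTop.eventually_ge_atTop _
  obtain ⟨N, hN⟩ := eventually_atTop.1 (e1.and (e2.and (e3.and (e4.and (eventually_gt_atTop 0)))))
  refine ⟨min (q / 2) (q ^ 2 / 8), (μ2 + 1) + (μ2 + 1) ^ 2, by positivity, N, fun n hn => ?_⟩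
  obtain ⟨h1, h2, h3, h4, h5⟩ := hN n hn
  have hn0 : (0 : ℝ) < n := by exact_mod_cast h5
  rw [lt_div_iff₀ hn0] at h1
  rw [div_lt_iff₀ hn0] at h2
  rw [div_le_iff₀ (by positivity)] at h4
  set g : Fin n → ℝ := fun i => if dseq n i = k then 1 else 0 with hg
  have hg01 : ∀ i, g i = 0 ∨ g i = 1 := fun i => by
    by_cases h : dseq n i = k <;> simp [hg, h]
  have hgs : ∑ i, g i = (Nat.card {i : Fin n // dseq n i = k} : ℝ) := by
    rw [hg, Finset.sum_boole, Nat.card_eq_fintype_card, Fintype.card_subtype]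
  rw [← hgs] at h1
  have hnn : ∀ i, 0 ≤ (dseq n i : ℝ) * ((dseq n i : ℝ) - 1) := fun i => nat_mul_sub_nonneg _
  have hle : ∀ i, (dseq n i : ℝ) * ((dseq n i : ℝ) - 1) ≤ (dseq n i : ℝ) ^ 2 := fun i => by
    have : (0 : ℝ) ≤ dseq n i := Nat.cast_nonneg _
    nlinarith
  have hgle : ∀ i, 2 * g i ≤ (dseq n i : ℝ) * ((dseq n i : ℝ) - 1) := fun i => by
    by_cases h : dseq n i = k
    · have : (2 : ℝ) ≤ k := by exact_mod_cast hk2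
      simp only [hg, h, if_true]
      nlinarith
    · simpa [hg, h] using hnn i
  have hg0 : ∀ i, 0 ≤ g i := fun i => by rcases hg01 i with h | h <;> simp [h]
  refine ⟨?_, ?_, ?_, ?_⟩
  · calc _ ≤ q / 2 * n := by gcongr; exact min_le_left _ _
      _ ≤ ∑ i, g i := h1.le
      _ ≤ _ := Finset.sum_le_sum fun i _ => by linarith [hgle i]
  · calc _ ≤ ∑ i, (dseq n i : ℝ) ^ 2 :=
          Finset.sum_le_sum fun i _ => by linarith [hle i, hnn i]
      _ ≤ (μ2 + 1) * n := h2.le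
      _ ≤ _ := mul_le_mul_of_nonneg_right (by linarith [sq_nonneg (μ2 + 1)]) hn0.le
  · have hpc := pair_count n (hseq n) g hg01 _ h3
    have hs : (q / 2 * n) ^ 2 ≤ (∑ i, g i) ^ 2 := by
      have := h1.le
      gcongr
    have hnb : (n : ℝ) ≤ q ^ 2 / 16 * (n : ℝ) ^ 2 := by nlinarith
    calc _ ≤ q ^ 2 / 8 * (n : ℝ) ^ 2 := by gcongr; exact min_le_right _ _
      _ ≤ 2 * (∑ x : Fin n × Fin n,
          if x.1 < x.2 ∧ ¬ (hseq n).Adj x.1 x.2 then g x.1 * g x.2 else 0) := by nlinarith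
      _ ≤ _ := by
        rw [Finset.mul_sum]
        refine Finset.sum_le_sum fun x _ => ?_
        split_ifs
        · have := mul_le_mul (hgle x.1) (hgle x.2) (by linarith [hg0 x.2]) (hnn x.1)
          nlinarith
        · simp
  · calc _ ≤ ∑ x : Fin n × Fin n, (dseq n x.1 : ℝ) ^ 2 * (dseq n x.2 : ℝ) ^ 2 := by
          refine Finset.sum_le_sum fun x _ => ?_
          split_ifs
          · exact mul_le_mul (by linarith [hle x.1, hnn x.1]) (hle x.2) (hnn x.2) (sq_nonneg _)
          · positivity
      _ = (∑ i, (dseq n i : ℝ) ^ 2) ^ 2 := by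
          rw [sq (∑ i, _), Finset.sum_mul_sum, Fintype.sum_prod_type]
      _ ≤ ((μ2 + 1) * n) ^ 2 := by have := h2.le; gcongr
      _ ≤ _ := by rw [mul_pow]; gcongr; linarith

end TWG
end
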